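/- Let α ∈ [1,2], let u₁, u₂ ∈ X^{0,1/2,1}, let N₁, N₂ ≥ 1 be dyadic numbers, let 0 < T < 1, and let a ∈ L^∞(R²) with ‖a‖_{L^∞} ≤ 1. Then there exist K₀ ≥ 1 and C > 0 depending only on p_{α+1} such that, if N₁∨N₂ ≥ K₀(N₁∧N₂), then for every θ ∈ [0,1] and every interval I ⊂ R with |I| ≤ (N₁∨N₂)^{−1} T: ‖Λ_a(P_{N₁}u₁, P_{N₂}u₂)‖_{L²(I; L²(T))} ≤ C T^{θ/2} (N₁∧N₂)^{θ/2} (N₁∨N₂)^{−1/2} ‖P_{N₁}u₁‖_{X^{0,1/2,1}} ‖P_{N₂}u₂‖_{X^{0,1/2,1}}. -/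

import Mathlib

open MeasureTheory Complex Real Set Filter
open scoped ENNReal NNReal

noncomputable section

/-- **Hypothesis 1**: `p` is the symbol of the dispersive operator `L_{α+1}`
(the Fourier multiplier by `-i p(ξ)`); `p` is an odd real-valued function of class `C¹`
on `ℝ` and `C²` away from the origin, and for `ξ ≥ ξ₀` the first and second derivatives
of `p` are comparable to `ξ^α` and `ξ^(α-1)` respectively. -/
structure Hyp1 (α ξ₀ c C : ℝ) (p : ℝ → ℝ) : Prop where
  xi0_pos : 0 < ξ₀
  c_pos : 0 < c
  c_le_C : c ≤ C
  smooth1 : ContDiff ℝ 1 p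
  smooth2 : ∀ x : ℝ, x ≠ 0 → ContDiffAt ℝ 2 p x
  odd : ∀ x : ℝ, p (-x) = -p x
  deriv_lb : ∀ ξ : ℝ, ξ₀ ≤ ξ → c * ξ ^ α ≤ deriv p ξ
  deriv_ub : ∀ ξ : ℝ, ξ₀ ≤ ξ → deriv p ξ ≤ C * ξ ^ α
  deriv2_lb : ∀ ξ : ℝ, ξ₀ ≤ ξ → c * ξ ^ (α - 1) ≤ deriv (deriv p) ξ
  deriv2_ub : ∀ ξ : ℝ, ξ₀ ≤ ξ → deriv (deriv p) ξ ≤ C * ξ ^ (α - 1)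

/-- The fixed smooth even cutoff function `χ`: `0 ≤ χ ≤ 1`, `χ ≡ 1` on `[-1,1]`,
`supp χ ⊆ [-2,2]`. -/
structure CutoffFun (χ : ℝ → ℝ) : Prop where
  smooth : ContDiff ℝ (⊤ : ℕ∞) χ
  even : ∀ x : ℝ, χ (-x) = χ x
  nonneg : ∀ x : ℝ, 0 ≤ χ x
  le_one : ∀ x : ℝ, χ x ≤ 1
  eq_one : ∀ x ∈ Set.Icc (-1 : ℝ) 1, χ x = 1
  compact_supp : ∀ x : ℝ, χ x ≠ 0 → x ∈ Set.Icc (-2 : ℝ) 2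

/-- The Littlewood–Paley symbol `φ_N`: for a dyadic `N ≥ 1`, `φ_N(ξ) = χ(ξ/N) - χ(2ξ/N)`,
and `φ_0(ξ) = χ(2ξ)`. -/
def lpSymb (χ : ℝ → ℝ) (N ξ : ℝ) : ℝ :=
  if N = 0 then χ (2 * ξ) else χ (ξ / N) - χ (2 * ξ / N)

/-- The Littlewood–Paley projector `P_N`, acting on the (spatial) Fourier coefficients
of a function on the torus. -/
def PN (χ : ℝ → ℝ) (N : ℝ) (u : ℤ → ℂ) : ℤ → ℂ := fun ξ => (lpSymb χ N ξ : ℂ) * u ξ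

/-- Square of the `L²(𝕋)` norm, computed on Fourier coefficients (Parseval). -/
def l2sq (v : ℤ → ℂ) : ℝ := ∑' ξ : ℤ, ‖v ξ‖ ^ 2

/-- `L²(S × 𝕋)` norm of a space-time function given by its spatial Fourier
coefficients `U t ξ`, `S ⊆ ℝ` a set of times. -/
def L2normOn (S : Set ℝ) (U : ℝ → ℤ → ℂ) : ℝ := (∫ t in S, l2sq (U t)) ^ ((1:ℝ)/2)

/-- `L²(ℝ × 𝕋)` norm. -/
def L2full (U : ℝ → ℤ → ℂ) : ℝ := (∫ t : ℝ, l2sq (U t)) ^ ((1:ℝ)/2)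

/-- `L^∞(]0,T[; L²(𝕋))` norm. -/
def LinfL2 (T : ℝ) (U : ℝ → ℤ → ℂ) : ℝ := ⨆ t : Set.Ioo (0:ℝ) T, (l2sq (U t)) ^ ((1:ℝ)/2)

/-- Membership in `L²(ℝ × 𝕋)`. -/
def MemL2 (U : ℝ → ℤ → ℂ) : Prop :=
  (∀ t : ℝ, Summable fun ξ : ℤ => ‖U t ξ‖ ^ 2) ∧
  (∀ ξ : ℤ, Measurable fun t : ℝ => U t ξ) ∧
  Integrable (fun t : ℝ => l2sq (U t))

/-- Membership in `L^∞(]0,T[; L²(𝕋))`, together with measurability of the coefficients. -/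
def MemLinfL2 (T : ℝ) (U : ℝ → ℤ → ℂ) : Prop :=
  (∀ t ∈ Set.Ioo (0:ℝ) T, Summable fun ξ : ℤ => ‖U t ξ‖ ^ 2) ∧
  (∀ ξ : ℤ, Measurable fun t : ℝ => U t ξ) ∧
  (∃ M : ℝ, ∀ t ∈ Set.Ioo (0:ℝ) T, l2sq (U t) ≤ M)

/-- Continuity with values in `L²(𝕋)` on `[0,T]`. -/
def ContL2On (T : ℝ) (U : ℝ → ℤ → ℂ) : Prop :=
  ∀ t₀ ∈ Set.Icc (0:ℝ) T,
    Filter.Tendsto (fun t => l2sq (fun ξ => U t ξ - U t₀ ξ))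
      (nhdsWithin t₀ (Set.Icc (0:ℝ) T)) (nhds 0)

/-- Time Fourier transform (with the convention `∫ e^{-iτt} g(t) dt`). -/
def FT (g : ℝ → ℂ) (τ : ℝ) : ℂ := ∫ t : ℝ, Complex.exp (-(Complex.I * τ * t)) * g t

/-- Inverse time Fourier transform. -/
def IFT (g : ℝ → ℂ) (t : ℝ) : ℂ :=
  (2 * Real.pi)⁻¹ • ∫ τ : ℝ, Complex.exp (Complex.I * τ * t) * g τ

/-- The modulation projector `Q_L`, a space-time Fourier multiplier with symbol
`ψ_L(τ,ξ) = φ_L(τ - p(ξ))` (acting on spatial Fourier coefficients `U t ξ`). -/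
def QL (χ p : ℝ → ℝ) (L : ℝ) (U : ℝ → ℤ → ℂ) : ℝ → ℤ → ℂ := fun t ξ =>
  IFT (fun τ => (lpSymb χ L (τ - p ξ) : ℂ) * FT (fun s => U s ξ) τ) t

/-- `Q_{≤ 2^l} = Q_0 + ∑_{j ≤ l} Q_{2^j}`. -/
def Qle (χ p : ℝ → ℝ) (l : ℕ) (U : ℝ → ℤ → ℂ) : ℝ → ℤ → ℂ := fun t ξ =>
  QL χ p 0 U t ξ + ∑ j ∈ Finset.range (l + 1), QL χ p ((2:ℝ) ^ j) U t ξ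

/-- The `X^{0,1/2,1}` (Besov–Bourgain) norm:
`‖u‖ = ∑_L max(L,1)^{1/2} ‖Q_L u‖_{L²(ℝ×𝕋)}`, `L` running over `{0} ∪ 2^ℕ`. -/
def Xhalf (χ p : ℝ → ℝ) (U : ℝ → ℤ → ℂ) : ℝ :=
  L2full (QL χ p 0 U) + ∑' l : ℕ, ((2:ℝ) ^ l) ^ ((1:ℝ)/2) * L2full (QL χ p ((2:ℝ) ^ l) U)

/-- Membership in `X^{0,1/2,1}` (with the regularity needed for all the
norms entering the statements to be given by genuinely convergent sums and
integrals). -/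
def MemX (χ p : ℝ → ℝ) (U : ℝ → ℤ → ℂ) : Prop :=
  (∀ ξ : ℤ, Measurable fun t : ℝ => U t ξ) ∧
  (∀ ξ : ℤ, Integrable fun t : ℝ => U t ξ) ∧
  (∀ t : ℝ, Summable fun ξ : ℤ => ‖QL χ p 0 U t ξ‖ ^ 2) ∧
  (∀ l : ℕ, ∀ t : ℝ, Summable fun ξ : ℤ => ‖QL χ p ((2:ℝ) ^ l) U t ξ‖ ^ 2) ∧
  Integrable (fun t : ℝ => l2sq (QL χ p 0 U t)) ∧
  (∀ l : ℕ, Integrable fun t : ℝ => l2sq (QL χ p ((2:ℝ) ^ l) U t)) ∧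
  Summable (fun l : ℕ => ((2:ℝ) ^ l) ^ ((1:ℝ)/2) * L2full (QL χ p ((2:ℝ) ^ l) U))

/-- The bilinear operator `Λ_a`:
`(Λ_a(u,v))^(ξ) = ∑_{ξ₁+ξ₂=ξ} a(ξ₁,ξ₂) û(ξ₁) v̂(ξ₂)`. -/
def Lam (a : ℝ → ℝ → ℂ) (u v : ℤ → ℂ) : ℤ → ℂ := fun ξ =>
  ∑' ξ₁ : ℤ, a ξ₁ ((ξ : ℝ) - ξ₁) * u ξ₁ * v (ξ - ξ₁)

/-- `u` solves `∂_t u + L_{α+1} u + ∂_x f = 0` on `]0,T[ × 𝕋` (in the distributional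
sense), formulated equivalently through the Duhamel formula on each spatial Fourier
mode; `U` and `F` are the spatial Fourier coefficients of `u` and `f`. -/
def Solves (p : ℝ → ℝ) (T : ℝ) (U F : ℝ → ℤ → ℂ) : Prop :=
  ∀ ξ : ℤ, ∀ t ∈ Set.Icc (0:ℝ) T,
    U t ξ = Complex.exp (Complex.I * (p ξ) * t) * U 0 ξ -
      ∫ s in (0:ℝ)..t,
        Complex.exp (Complex.I * (p ξ) * (t - s)) * (Complex.I * (ξ:ℂ)) * F s ξ

/-- Fourier coefficients of the free evolution `e^{-tL_{α+1}} φ`. -/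
def freeEvol (p : ℝ → ℝ) (φ : ℤ → ℂ) : ℝ → ℤ → ℂ := fun t ξ =>
  Complex.exp (Complex.I * (p ξ) * t) * φ ξ


open scoped FourierTransform SchwartzMap in
lemma flip_fourier {f g : ℝ → ℂ} (hf : Integrable f) (hg : Integrable g) :
    ∫ x, 𝓕 f x * g x = ∫ x, f x * 𝓕 g x := by
  have := VectorFourier.integral_fourierIntegral_smul_eq_flip (L := innerₗ ℝ) (μ := volume) (ν := volume)
    Real.continuous_fourierChar continuous_inner hf hg
  simpa [smul_eq_mul] using! this

open scoped FourierTransform SchwartzMap in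
lemma flip_fourierInv {f g : ℝ → ℂ} (hf : Integrable f) (hg : Integrable g) :
    ∫ x, 𝓕⁻ f x * g x = ∫ x, f x * 𝓕⁻ g x := by
  have := VectorFourier.integral_fourierIntegral_smul_eq_flip (L := -innerₗ ℝ) (μ := volume) (ν := volume)
    Real.continuous_fourierChar (by simp; fun_prop) hf hg
  have hfl : (-innerₗ ℝ : ℝ →ₗ[ℝ] ℝ →ₗ[ℝ] ℝ).flip = -innerₗ ℝ := by ext; simp
  rw [hfl] at this
  simpa only [smul_eq_mul] using! this

open scoped FourierTransform SchwartzMap in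
lemma continuous_fourier_of_int {f : ℝ → ℂ} (hf : Integrable f) : Continuous (𝓕 f) :=
  VectorFourier.fourierIntegral_continuous (L := innerₗ ℝ) Real.continuous_fourierChar continuous_inner hf

open scoped FourierTransform SchwartzMap in
lemma continuous_fourierInv_of_int {f : ℝ → ℂ} (hf : Integrable f) : Continuous (𝓕⁻ f) :=
  VectorFourier.fourierIntegral_continuous (L := -innerₗ ℝ) Real.continuous_fourierChar
    (by simp; fun_prop) hf

open scoped FourierTransform SchwartzMap in
lemma inversion_ae {f : ℝ → ℂ} (hf : Integrable f) (hf' : Integrable (𝓕 f)) :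
    ∀ᵐ x, f x = 𝓕⁻ (𝓕 f) x := by
  apply ae_eq_of_integral_contDiff_smul_eq hf.locallyIntegrable
    (continuous_fourierInv_of_int hf').locallyIntegrable
  intro g hg hgc
  have h1 : HasCompactSupport (fun x => (g x : ℂ)) := hgc.comp_left (g := fun x : ℝ => (x:ℂ)) (by simp)
  let gs : 𝓢(ℝ, ℂ) := h1.toSchwartzMap (Complex.ofRealCLM.contDiff.comp hg)
  have hgs : ∀ x, gs x = (g x : ℂ) := fun x => rfl
  have e1 : ∀ x, g x • f x = 𝓕 (𝓕⁻ gs : 𝓢(ℝ, ℂ)) x * f x := by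
    intro x; simp [hgs]
  have e2 : ∀ x, g x • 𝓕⁻ (𝓕 f) x = gs x * 𝓕⁻ (𝓕 f) x := by
    intro x; simp [hgs]
  simp_rw [e1, e2]
  rw [SchwartzMap.fourier_coe, flip_fourier (SchwartzMap.integrable _) hf,
    ← flip_fourierInv (SchwartzMap.integrable _) hf', SchwartzMap.fourierInv_coe]

open scoped FourierTransform SchwartzMap in
lemma plancherel_inv {f : ℝ → ℂ} (hf : Integrable f) (hf2 : MemLp f 2) :
    eLpNorm (𝓕⁻ f) 2 volume = eLpNorm f 2 volume := by
  have key : ∀ᵐ x, (𝓕⁻ (hf2.toLp f) : Lp ℂ 2 (volume : Measure ℝ)) x = 𝓕⁻ f x := by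
    apply ae_eq_of_integral_contDiff_smul_eq ((Lp.memLp _).locallyIntegrable (by norm_num))
      (continuous_fourierInv_of_int hf).locallyIntegrable
    intro g hg hgc
    have h1 : HasCompactSupport (fun x => (g x : ℂ)) := hgc.comp_left (g := fun x : ℝ => (x:ℂ)) (by simp)
    let gs : 𝓢(ℝ, ℂ) := h1.toSchwartzMap (Complex.ofRealCLM.contDiff.comp hg)
    have hgs : ∀ x, gs x = (g x : ℂ) := fun x => rfl
    have h2 := congrArg (fun d : 𝓢'(ℝ, ℂ) => d gs) (Lp.fourierInv_toTemperedDistribution_eq (hf2.toLp f))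
    have h3 : (𝓕⁻ ((hf2.toLp f : Lp ℂ 2 (volume : Measure ℝ)) : 𝓢'(ℝ, ℂ))) gs
      = ((hf2.toLp f : Lp ℂ 2 (volume : Measure ℝ)) : 𝓢'(ℝ, ℂ)) (𝓕⁻ gs) := rfl
    simp only [h3, Lp.toTemperedDistribution_apply] at h2
    have e2 : ∫ x, g x • 𝓕⁻ f x = ∫ x, (𝓕⁻ gs) x • f x := by
      simp only [smul_eq_mul]
      rw [SchwartzMap.fourierInv_coe, flip_fourierInv (SchwartzMap.integrable _) hf]
      simp [hgs]
    rw [e2]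
    have e3 : ∫ x, (𝓕⁻ gs) x • f x = ∫ x, (𝓕⁻ gs) x • (hf2.toLp f) x := by
      apply integral_congr_ae
      filter_upwards [hf2.coeFn_toLp] with x hx
      rw [hx]
    rw [e3, h2]
    simp [hgs]
  rw [← eLpNorm_congr_ae key, ← eLpNorm_congr_ae hf2.coeFn_toLp]
  have h4 : ‖(𝓕⁻ (hf2.toLp f) : Lp ℂ 2 (volume : Measure ℝ))‖ = ‖hf2.toLp f‖ :=
    (Lp.fourierTransformₗᵢ ℝ ℂ).symm.norm_map _
  rw [Lp.norm_def, Lp.norm_def] at h4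
  exact (ENNReal.toReal_eq_toReal_iff' (Lp.memLp _).2.ne (Lp.memLp _).2.ne).1 h4
open scoped FourierTransform in
lemma FT_eq (g : ℝ → ℂ) (τ : ℝ) : FT g τ = 𝓕 g (τ / (2 * π)) := by
  rw [Real.fourier_real_eq_integral_exp_smul, FT]
  congr 1; ext t
  rw [smul_eq_mul]
  congr 2
  have : (π : ℂ) ≠ 0 := by exact_mod_cast Real.pi_ne_zero
  push_cast
  field_simp

open scoped FourierTransform in
lemma IFT_eq (h : ℝ → ℂ) (t : ℝ) : IFT h t = 𝓕⁻ (fun s => h (2 * π * s)) t := by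
  rw [Real.fourierInv_eq', IFT]
  have := Measure.integral_comp_mul_left (fun τ : ℝ => Complex.exp (Complex.I * τ * t) * h τ) (2 * π)
  rw [abs_of_pos (by positivity)] at this
  rw [← this]
  congr 1; ext s
  rw [smul_eq_mul]
  congr 2
  simp
  ring

lemma continuous_FT {g : ℝ → ℂ} (hg : Integrable g) : Continuous (FT g) := by
  have : FT g = fun τ => _ := funext (FT_eq g)
  rw [this]
  exact (continuous_fourier_of_int hg).comp (by fun_prop)

lemma continuous_IFT {g : ℝ → ℂ} (hg : Integrable g) : Continuous (IFT g) := by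
  have : IFT g = fun τ => _ := funext (IFT_eq g)
  rw [this]
  exact (continuous_fourierInv_of_int (hg.comp_mul_left' (by positivity)))

lemma lint_comp_mul (f : ℝ → ℝ≥0∞) {a : ℝ} (ha : 0 < a) :
    ENNReal.ofReal a * ∫⁻ x, f (a * x) = ∫⁻ x, f x := by
  conv_rhs => rw [← Real.smul_map_volume_mul_left ha.ne']
  rw [lintegral_smul_measure, abs_of_pos ha]
  have := lintegral_map_equiv (μ := volume) f (MeasurableEquiv.mulLeft₀ a ha.ne')
  simp only [smul_eq_mul]
  congr 1
  exact this.symm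

lemma IFT_plancherel {h : ℝ → ℂ} (h1 : Integrable h) (h2 : MemLp h 2) :
    ∫⁻ τ, ‖h τ‖ₑ ^ 2 = ENNReal.ofReal (2 * π) * ∫⁻ t, ‖IFT h t‖ₑ ^ 2 := by
  have hp : 0 < 2 * π := by positivity
  rw [← lint_comp_mul _ hp]
  congr 1
  have e : IFT h = fun τ => _ := funext (IFT_eq h)
  have i1 : Integrable (fun s => h (2 * π * s)) := h1.comp_mul_left' hp.ne'
  have i2 : MemLp (fun s => h (2 * π * s)) 2 := by
    rw [memLp_two_iff_integrable_sq_norm i1.1]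
    have := (memLp_two_iff_integrable_sq_norm h1.1).1 h2
    exact this.comp_mul_left' (g := fun x => ‖h x‖^2) hp.ne'
  have := plancherel_inv i1 i2
  rw [eLpNorm_eq_lintegral_rpow_enorm_toReal (by norm_num) (by norm_num),
    eLpNorm_eq_lintegral_rpow_enorm_toReal (by norm_num) (by norm_num)] at this
  have := ENNReal.rpow_left_injective (by norm_num) this
  rw [e]
  simpa using this.symm

lemma IFT_FT {g : ℝ → ℂ} (h1 : Integrable g) (h2 : Integrable (FT g)) :
    ∀ᵐ t, g t = IFT (FT g) t := by
  have hp : 0 < 2 * π := by positivity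
  have e : (fun s => FT g (2 * π * s)) = FourierTransform.fourier g := by
    ext s; rw [FT_eq]; field_simp
  have i2 := h2.comp_mul_left' hp.ne'
  rw [e] at i2
  filter_upwards [inversion_ae h1 i2] with t ht
  rw [IFT_eq, e]; exact ht
lemma gauss_int (N ω t0 : ℝ) (hN : 0 < N) :
    ‖∫ t : ℝ, Complex.exp (I * ω * t) * (Real.exp (-(N * (t - t0)) ^ 2) : ℂ)‖
      = √π / N * Real.exp (-ω ^ 2 / (4 * N ^ 2)) := by
  have h1 := fourierIntegral_gaussian (b := ((N:ℂ)^2)) (by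
    rw [← Complex.ofReal_pow, Complex.ofReal_re]; positivity) (ω : ℂ)
  have h2 : ∫ t : ℝ, Complex.exp (I * ω * t) * (Real.exp (-(N * (t - t0)) ^ 2) : ℂ)
      = Complex.exp (I * ω * t0) * ∫ t : ℝ, Complex.exp (I * ω * t) * Complex.exp (-(N:ℂ)^2 * t ^ 2) := by
    rw [← integral_const_mul, ← integral_sub_right_eq_self (fun t : ℝ => Complex.exp (I * ω * t0) * (Complex.exp (I * ω * t) * Complex.exp (-(N:ℂ)^2 * t ^ 2))) t0]
    congr 1; ext t
    rw [← mul_assoc, ← Complex.exp_add, Complex.ofReal_exp, ← Complex.exp_add, ← Complex.exp_add]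
    congr 1; push_cast; ring
  rw [h2, h1, norm_mul, norm_mul]
  have e1 : ‖Complex.exp (I * ω * t0)‖ = 1 := by
    rw [Complex.norm_exp]; simp
  have e2 : (π : ℂ) / (N:ℂ)^2 = ((π / N^2 : ℝ) : ℂ) := by push_cast; rfl
  have e3 : ‖((π : ℂ) / (N:ℂ)^2) ^ (1/2 : ℂ)‖ = √π / N := by
    rw [e2, Complex.norm_cpow_eq_rpow_re_of_pos (by positivity)]
    have : ((1/2 : ℂ)).re = 1/2 := by norm_num
    rw [this, ← Real.sqrt_eq_rpow, Real.sqrt_div (by positivity), Real.sqrt_sq hN.le]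
  have e4 : ‖Complex.exp (-(ω:ℂ)^2 / (4 * (N:ℂ)^2))‖ = Real.exp (-ω ^ 2 / (4 * N ^ 2)) := by
    rw [Complex.norm_exp]
    congr 1
    have : (-(ω:ℂ)^2 / (4 * (N:ℂ)^2)) = ((-ω ^ 2 / (4 * N ^ 2) : ℝ) : ℂ) := by push_cast; rfl
    rw [this, Complex.ofReal_re]
  rw [e1, e3, e4, one_mul]

lemma summable_gauss {κ : ℝ} (hκ : 0 < κ) : Summable (fun k : ℤ => Real.exp (-κ * (k:ℝ) ^ 2)) := by
  have h := ((Real.summable_one_div_int_pow (p := 2)).2 (by norm_num)).mul_left (1 / κ)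
  refine Summable.of_norm_bounded_eventually h ?_
  have : {(0:ℤ)}ᶜ ∈ (cofinite : Filter ℤ) := (Set.finite_singleton 0).compl_mem_cofinite
  filter_upwards [this] with k hk
  have hk0 : (k:ℝ) ≠ 0 := by simpa using hk
  have hk2 : 0 < κ * (k:ℝ)^2 := by positivity
  rw [Real.norm_of_nonneg (Real.exp_pos _).le, neg_mul, Real.exp_neg, div_mul_div_comm, one_mul,
    inv_eq_one_div]
  exact one_div_le_one_div_of_le hk2 (by linarith [Real.add_one_le_exp (κ * (k:ℝ)^2)])

lemma schur_aux (S : Finset ℤ) (β : ℤ → ℝ) (f : ℤ → ℝ) (hf0 : ∀ k, 0 ≤ f k)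
    (hfs : Summable f) (hfe : ∀ k, f (-k) = f k) :
    ∑ m ∈ S, ∑ m' ∈ S, β m * β m' * f (m - m') ≤ (∑' k, f k) * ∑ m ∈ S, β m ^ 2 := by
  have key : ∀ m, ∑ m' ∈ S, f (m - m') ≤ ∑' k, f k := by
    intro m
    rw [← Finset.sum_image (f := f) (g := fun m' => m - m') (by intro a _ b _ h; simpa using h)]
    exact hfs.sum_le_tsum _ (fun i _ => hf0 i)
  have h1 : ∑ m ∈ S, ∑ m' ∈ S, β m * β m' * f (m - m') ≤
      ∑ m ∈ S, ∑ m' ∈ S, (β m ^ 2 / 2 * f (m - m') + β m' ^ 2 / 2 * f (m - m')) := by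
    refine Finset.sum_le_sum fun m _ => Finset.sum_le_sum fun m' _ => ?_
    rw [← add_mul]
    exact mul_le_mul_of_nonneg_right (by nlinarith [sq_nonneg (β m - β m')]) (hf0 _)
  have h2 : ∑ m ∈ S, ∑ m' ∈ S, β m ^ 2 / 2 * f (m - m') ≤ (∑' k, f k) * ∑ m ∈ S, β m ^ 2 / 2 := by
    rw [Finset.mul_sum]
    refine Finset.sum_le_sum fun m _ => ?_
    rw [← Finset.mul_sum, mul_comm]
    exact mul_le_mul_of_nonneg_right (key m) (by positivity)
  have h3 : ∑ m ∈ S, ∑ m' ∈ S, β m' ^ 2 / 2 * f (m - m') = ∑ m ∈ S, ∑ m' ∈ S, β m ^ 2 / 2 * f (m - m') := by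
    rw [Finset.sum_comm]
    refine Finset.sum_congr rfl fun m _ => Finset.sum_congr rfl fun m' _ => ?_
    rw [← hfe, neg_sub]
  simp only [Finset.sum_add_distrib] at h1
  rw [h3] at h1
  rw [← Finset.sum_div] at h2
  linarith

lemma sieve {κ : ℝ} (hκ : 0 < κ) : ∃ G : ℝ, 0 < G ∧ ∀ (N : ℝ), 0 < N → ∀ (S : Finset ℤ) (ω : ℤ → ℝ)
    (b : ℤ → ℂ) (A B : ℝ), (∀ m ∈ S, ∀ m' ∈ S, κ * N * |(m:ℝ) - m'| ≤ |ω m - ω m'|) → B - A ≤ N⁻¹ →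
    ∫⁻ t in Ioo A B, ‖∑ m ∈ S, b m * Complex.exp (I * ω m * t)‖ₑ ^ 2 ≤
      ENNReal.ofReal (G / N) * ∑ m ∈ S, ‖b m‖ₑ ^ 2 := by
  have hsg := summable_gauss (κ := κ^2 / 4) (by positivity)
  set f : ℤ → ℝ := fun k : ℤ => Real.exp (-(κ^2/4) * (k:ℝ) ^ 2) with hf
  have hG : 0 < ∑' k, f k := hsg.tsum_pos (fun k => (Real.exp_pos _).le) 0 (Real.exp_pos _)
  refine ⟨Real.exp 1 * √π * ∑' k, f k, by positivity, ?_⟩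
  intro N hN S ω b A B hsep hAB
  set w : ℝ → ℝ := fun t => Real.exp (-(N * (t - A)) ^ 2) with hw
  set Z : ℝ → ℂ := fun t => ∑ m ∈ S, b m * Complex.exp (I * ω m * t) with hZ
  have hwint : Integrable w := by
    have := (integrable_exp_neg_mul_sq (b := N^2) (by positivity)).comp_sub_right A
    refine this.congr (ae_of_all _ fun t => ?_)
    simp only [hw]; congr 1; ring
  have hterm : ∀ m m', Integrable (fun t : ℝ => Complex.exp (I * (ω m - ω m' : ℝ) * t) * (w t : ℂ)) := by
    intro m m'
    refine hwint.ofReal.bdd_mul (c := 1) (by fun_prop) (ae_of_all _ fun t => ?_)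
    rw [Complex.norm_exp]; simp
  have hexp : ∀ t, ((w t * ‖Z t‖ ^ 2 : ℝ) : ℂ) = ∑ m ∈ S, ∑ m' ∈ S,
      (b m * (starRingEnd ℂ) (b m')) * (Complex.exp (I * (ω m - ω m' : ℝ) * t) * (w t : ℂ)) := by
    intro t
    have : ((‖Z t‖ ^ 2 : ℝ) : ℂ) = Z t * (starRingEnd ℂ) (Z t) := by
      rw [Complex.mul_conj, Complex.normSq_eq_norm_sq]
    rw [Complex.ofReal_mul, this, hZ]
    simp only [map_sum, map_mul]
    rw [Finset.sum_mul_sum]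
    simp only [Finset.mul_sum]
    refine Finset.sum_congr rfl fun m _ => Finset.sum_congr rfl fun m' _ => ?_
    have : Complex.exp (I * (ω m - ω m' : ℝ) * t) = Complex.exp (I * ω m * t) *
        (starRingEnd ℂ) (Complex.exp (I * ω m' * t)) := by
      rw [← Complex.exp_conj, ← Complex.exp_add]
      congr 1
      simp; ring
    rw [this]; ring
  have hwZC : Integrable (fun t => ((w t * ‖Z t‖ ^ 2 : ℝ) : ℂ)) := by
    simp_rw [hexp]
    exact integrable_finsetSum _ fun m _ => integrable_finsetSum _ fun m' _ => (hterm m m').const_mul _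
  have hwZ : Integrable (fun t => w t * ‖Z t‖ ^ 2) := by
    have := hwZC.re
    exact this.congr (ae_of_all _ fun t => Complex.ofReal_re _)
  have hbound : ∫ t, w t * ‖Z t‖ ^ 2 ≤ √π / N * ((∑' k, f k) * ∑ m ∈ S, ‖b m‖ ^ 2) := by
    calc ∫ t, w t * ‖Z t‖ ^ 2 ≤ ‖∫ t, ((w t * ‖Z t‖ ^ 2 : ℝ) : ℂ)‖ := by
          rw [integral_complex_ofReal, Complex.norm_real]; exact le_abs_self _
      _ = ‖∑ m ∈ S, ∑ m' ∈ S, (b m * (starRingEnd ℂ) (b m')) *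
            ∫ t : ℝ, (Complex.exp (I * (ω m - ω m' : ℝ) * t) * (w t : ℂ))‖ := by
          simp_rw [hexp]
          rw [integral_finsetSum _ (fun m _ => integrable_finsetSum _ fun m' _ => (hterm m m').const_mul _)]
          congr 1
          refine Finset.sum_congr rfl fun m _ => ?_
          rw [integral_finsetSum _ (fun m' _ => (hterm m m').const_mul _)]
          simp_rw [integral_const_mul]
      _ ≤ ∑ m ∈ S, ∑ m' ∈ S, ‖b m‖ * ‖b m'‖ * (√π / N * f (m - m')) := by
          refine (norm_sum_le _ _).trans (Finset.sum_le_sum fun m hm => ?_)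
          refine (norm_sum_le _ _).trans (Finset.sum_le_sum fun m' hm' => ?_)
          rw [norm_mul, norm_mul, RCLike.norm_conj, gauss_int N _ A hN]
          gcongr
          simp only [hf]
          apply Real.exp_le_exp.2
          have h1 := hsep m hm m' hm'
          have h2 : (κ * N * |(m:ℝ) - m'|)^2 ≤ (ω m - ω m')^2 := by
            rw [← sq_abs (ω m - ω m')]
            exact pow_le_pow_left₀ (by positivity) h1 2
          rw [mul_pow, sq_abs] at h2
          push_cast
          rw [neg_div, neg_mul, neg_le_neg_iff, le_div_iff₀ (by positivity)]
          nlinarith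
      _ = √π / N * ∑ m ∈ S, ∑ m' ∈ S, ‖b m‖ * ‖b m'‖ * f (m - m') := by
          simp_rw [Finset.mul_sum]
          refine Finset.sum_congr rfl fun m _ => Finset.sum_congr rfl fun m' _ => ?_
          ring
      _ ≤ _ := by
          gcongr
          exact schur_aux S (fun m => ‖b m‖) f (fun k => (Real.exp_pos _).le) hsg
            (fun k => by simp [hf])
  calc ∫⁻ t in Ioo A B, ‖Z t‖ₑ ^ 2 ≤ ∫⁻ t in Ioo A B, ENNReal.ofReal (Real.exp 1 * (w t * ‖Z t‖^2)) := by
        refine setLIntegral_mono' measurableSet_Ioo fun t ht => ?_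
        rw [← ofReal_norm, ← ENNReal.ofReal_pow (norm_nonneg _)]
        apply ENNReal.ofReal_le_ofReal
        rw [← mul_assoc]
        apply le_mul_of_one_le_left (by positivity)
        rw [hw, ← Real.exp_add]
        apply Real.one_le_exp
        have h1 : N * (t - A) ≤ 1 := by
          have : t - A ≤ N⁻¹ := by linarith [ht.2]
          calc N * (t - A) ≤ N * N⁻¹ := by gcongr
            _ = 1 := by field_simp
        have h0 : 0 ≤ N * (t - A) := mul_nonneg hN.le (by linarith [ht.1])
        nlinarith
    _ ≤ ∫⁻ t, ENNReal.ofReal (Real.exp 1 * (w t * ‖Z t‖^2)) := setLIntegral_le_lintegral _ _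
    _ = ENNReal.ofReal (Real.exp 1 * ∫ t, w t * ‖Z t‖ ^ 2) := by
        rw [← integral_const_mul, ofReal_integral_eq_lintegral_ofReal (hwZ.const_mul _)]
        exact ae_of_all _ fun t => by positivity
    _ ≤ ENNReal.ofReal (Real.exp 1 * √π * (∑' k, f k) / N * ∑ m ∈ S, ‖b m‖ ^ 2) := by
        apply ENNReal.ofReal_le_ofReal
        calc _ ≤ Real.exp 1 * (√π / N * ((∑' k, f k) * ∑ m ∈ S, ‖b m‖ ^ 2)) := by gcongr
          _ = _ := by ring
    _ = _ := by
        rw [ENNReal.ofReal_mul (by positivity), ENNReal.ofReal_sum_of_nonneg (fun i _ => by positivity)]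
        simp_rw [← ofReal_norm, ENNReal.ofReal_pow (norm_nonneg _)]
lemma phase_sep {α ξ₀ c₀ C₀ : ℝ} (hα : α ∈ Set.Icc (1:ℝ) 2)
    {p : ℝ → ℝ} (hp : Hyp1 α ξ₀ c₀ C₀ p) :
    ∃ K₀ : ℝ, 1 ≤ K₀ ∧ ∃ κ : ℝ, 0 < κ ∧ ∀ N M : ℝ, 1 ≤ M → K₀ * M ≤ N →
      ∀ k m k' m' : ℝ, k + m = k' + m' → N / 2 ≤ |k| → N / 2 ≤ |k'| → |m| ≤ 2 * M → |m'| ≤ 2 * M →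
      κ * N * |m - m'| ≤ |(p k + p m) - (p k' + p m')| := by
  obtain ⟨hα1, hα2⟩ := hα
  have hc := hp.c_pos
  have hx := hp.xi0_pos
  have hC : 0 < C₀ := hc.trans_le hp.c_le_C
  have hdiff : Differentiable ℝ p := hp.smooth1.differentiable (by norm_num)
  have hdc : Continuous (deriv p) := hp.smooth1.continuous_deriv (by norm_num)
  have heven : ∀ x, deriv p (-x) = deriv p x := by
    intro x
    have h1 : p = fun y => -p (-y) := by ext y; rw [hp.odd]; ring
    conv_rhs => rw [h1]
    rw [deriv.fun_neg, deriv_comp_neg]; ring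
  have habs : ∀ x, deriv p |x| = deriv p x := by
    intro x
    rcases abs_choice x with h | h <;> rw [h]
    exact heven x
  obtain ⟨B, hB⟩ := (isCompact_Icc (a := -ξ₀) (b := ξ₀)).exists_bound_of_continuousOn hdc.continuousOn
  have hB0 : 0 ≤ B := (norm_nonneg _).trans (hB 0 ⟨by linarith, by linarith⟩)
  set K₀ := 8 + 2 * ξ₀ + 16 * C₀ / c₀ + 8 * B / c₀ with hK
  have hCc : 0 < 16 * C₀ / c₀ := by positivity
  have hBc : 0 ≤ 8 * B / c₀ := by positivity
  have hK8 : 8 ≤ K₀ := by linarith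
  refine ⟨K₀, by linarith, c₀ / 4, by positivity, ?_⟩
  intro N M hM hNM k m k' m' hsum hk hk' hm hm'
  have hNK : K₀ ≤ N := by nlinarith
  set R := (N / 2) ^ α with hR
  have hRN : N / 2 ≤ R := by
    calc N / 2 = (N/2) ^ (1:ℝ) := (Real.rpow_one _).symm
      _ ≤ _ := Real.rpow_le_rpow_of_exponent_le (by linarith) hα1
  have hR0 : 0 < R := by linarith
  -- upper bound
  have hup : ∀ x, |x| ≤ 2 * M → |deriv p x| ≤ c₀ / 2 * R := by
    intro x hxM
    have b1 : B ≤ c₀ / 4 * R := by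
      have : 8 * B / c₀ ≤ 2 * R := by linarith
      rw [div_le_iff₀ hc] at this; linarith
    by_cases hx0 : |x| ≤ ξ₀
    · have := hB x (abs_le.1 hx0)
      rw [Real.norm_eq_abs] at this
      nlinarith
    · push Not at hx0
      rw [← habs]
      have h1 := hp.deriv_lb _ hx0.le
      have h2 := hp.deriv_ub _ hx0.le
      have h3 : 0 ≤ |x| ^ α := by positivity
      rw [abs_of_nonneg (by nlinarith)]
      have h4 : |x| ^ α ≤ 4 / K₀ * R := by
        calc |x| ^ α ≤ (4 / K₀ * (N / 2)) ^ α := by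
              apply Real.rpow_le_rpow (abs_nonneg _) _ (by linarith)
              refine hxM.trans ?_
              rw [div_mul_eq_mul_div, le_div_iff₀ (by linarith)]
              linarith
          _ = (4 / K₀) ^ α * R := Real.mul_rpow (by positivity) (by linarith)
          _ ≤ 4 / K₀ * R := by
              gcongr
              calc (4 / K₀) ^ α ≤ (4 / K₀) ^ (1:ℝ) := 
                    Real.rpow_le_rpow_of_exponent_ge (by positivity) (by rw [div_le_one (by linarith)]; linarith) hα1
                _ = _ := Real.rpow_one _
      have h5 : C₀ * (4 / K₀) ≤ c₀ / 4 := by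
        have : 16 * C₀ / c₀ ≤ K₀ := by linarith
        rw [div_le_iff₀ hc] at this
        rw [mul_div_assoc', div_le_iff₀ (by linarith)]
        linarith
      calc deriv p |x| ≤ C₀ * (4 / K₀ * R) := h2.trans (by gcongr)
        _ = C₀ * (4 / K₀) * R := by ring
        _ ≤ c₀ / 2 * R := by gcongr; linarith
  have hpm : |p m - p m'| ≤ c₀ / 2 * R * |m - m'| := by
    have := Convex.norm_image_sub_le_of_norm_deriv_le (f := p) (s := Icc (-(2*M)) (2*M)) (C := c₀/2*R)
      (fun x _ => hdiff x) (fun x hx => hup x (abs_le.2 hx)) (convex_Icc _ _) (abs_le.1 hm') (abs_le.1 hm)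
    simpa [Real.norm_eq_abs] using this
  have hpos : ∀ x y : ℝ, N / 2 ≤ x → N / 2 ≤ y → c₀ * R * |x - y| ≤ |p x - p y| := by
    have aux : ∀ x y : ℝ, N / 2 ≤ x → x ≤ y → c₀ * R * (y - x) ≤ p y - p x := by
      intro x y h1 h2
      refine Convex.mul_sub_le_image_sub_of_le_deriv (convex_Ici (N/2)) hdiff.continuous.continuousOn
        hdiff.differentiableOn ?_ x h1 y (h1.trans h2) h2
      intro z hz
      rw [interior_Ici] at hz
      have hz' : N / 2 ≤ z := le_of_lt hz
      refine le_trans ?_ (hp.deriv_lb z (by linarith))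
      gcongr
      exact Real.rpow_le_rpow (by linarith) hz' (by linarith)
    intro x y h1 h2
    rcases le_total x y with h | h
    · rw [abs_sub_comm, abs_sub_comm (p x)]
      rw [abs_of_nonneg (by linarith : 0 ≤ y - x)]
      exact (aux x y h1 h).trans (le_abs_self _)
    · rw [abs_of_nonneg (by linarith : 0 ≤ x - y)]
      exact (aux y x h2 h).trans (le_abs_self _)
  have hkk : k - k' = m' - m := by linarith
  have hsmall : |k - k'| < N := by
    rw [hkk]
    have := abs_sub m' m
    nlinarith
  have hpk : c₀ * R * |k - k'| ≤ |p k - p k'| := by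
    rcases le_abs.1 hk with h | h <;> rcases le_abs.1 hk' with h' | h'
    · exact hpos k k' h h'
    · exfalso; rw [abs_lt] at hsmall; linarith
    · exfalso; rw [abs_lt] at hsmall; linarith
    · have := hpos (-k) (-k') h h'
      rw [hp.odd, hp.odd] at this
      rw [show -k - -k' = -(k - k') by ring, abs_neg, show -p k - -p k' = -(p k - p k') by ring,
        abs_neg] at this
      exact this
  rw [hkk, abs_sub_comm] at hpk
  have h6 : |p k - p k'| - |p m - p m'| ≤ |(p k + p m) - (p k' + p m')| := by
    have h7 : (p k + p m) - (p k' + p m') = (p k - p k') - (p m' - p m) := by ring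
    rw [h7, abs_sub_comm (p m)]
    exact abs_sub_abs_le_abs_sub _ _
  have h8 : c₀ / 4 * N * |m - m'| ≤ c₀ / 2 * R * |m - m'| := by
    gcongr ?_ * _
    nlinarith
  nlinarith
/-- `ℓ²` norm over a finite set of modes, as an extended nonnegative real. -/
def nrm (S : Finset ℤ) (x : ℤ → ℂ) : ℝ≥0∞ := (∑ k ∈ S, ‖x k‖ₑ ^ 2) ^ ((1:ℝ)/2)

lemma nrm_sq (S : Finset ℤ) (x : ℤ → ℂ) : nrm S x ^ 2 = ∑ k ∈ S, ‖x k‖ₑ ^ 2 := by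
  rw [nrm, ← ENNReal.rpow_natCast, ← ENNReal.rpow_mul]; norm_num

lemma nrm_ne_top (S : Finset ℤ) (x : ℤ → ℂ) : nrm S x ≠ ⊤ := by
  apply ENNReal.rpow_ne_top_of_nonneg (by norm_num)
  exact ENNReal.sum_ne_top.2 fun k _ => by simp

lemma le_nrm (S : Finset ℤ) (x : ℤ → ℂ) {k : ℤ} (hk : k ∈ S) : ‖x k‖ₑ ≤ nrm S x := by
  have : ‖x k‖ₑ ^ 2 ≤ nrm S x ^ 2 := by
    rw [nrm_sq]
    exact Finset.single_le_sum (f := fun k => ‖x k‖ₑ ^ 2) (fun _ _ => zero_le) hk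
  exact (ENNReal.pow_le_pow_left_iff two_ne_zero).1 this

lemma measurable_nrm (S : Finset ℤ) {F : ℝ → ℤ → ℂ} (hF : ∀ k, Measurable fun σ => F σ k) :
    Measurable fun σ => nrm S (F σ) := by
  unfold nrm
  refine Measurable.pow_const ?_ _
  exact Finset.measurable_fun_sum _ fun k _ => (hF k).enorm.pow_const _

lemma wCS {Ω : Type*} [MeasurableSpace Ω] (μ : Measure Ω) {h W : Ω → ℝ≥0∞} (hh : Measurable h)
    (hW : Measurable W) (h0 : ∀ z, W z = 0 → h z = 0) (ht : ∀ z, W z ≠ ⊤) :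
    (∫⁻ z, h z ∂μ) ^ 2 ≤ (∫⁻ z, W z ∂μ) * ∫⁻ z, (W z)⁻¹ * h z ^ 2 ∂μ := by
  have e : ∀ z, h z = W z ^ ((1:ℝ)/2) * ((W z)⁻¹ * h z ^ 2) ^ ((1:ℝ)/2) := by
    intro z
    rw [← ENNReal.mul_rpow_of_nonneg _ _ (by norm_num), ← mul_assoc]
    by_cases hz : W z = 0
    · simp [hz, h0 z hz]
    · rw [ENNReal.mul_inv_cancel hz (ht z), one_mul, ← ENNReal.rpow_natCast, ← ENNReal.rpow_mul]
      norm_num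
  have := ENNReal.lintegral_mul_norm_pow_le (μ := μ) hW.aemeasurable
    ((hW.inv.mul (hh.pow_const 2))).aemeasurable (p := (1:ℝ)/2) (q := (1:ℝ)/2) (by norm_num) (by norm_num) (by norm_num)
  simp only [Pi.mul_apply, Pi.inv_apply] at this
  rw [← lintegral_congr e, ← ENNReal.mul_rpow_of_nonneg _ _ (by norm_num)] at this
  calc (∫⁻ z, h z ∂μ) ^ 2 ≤ _ := pow_le_pow_left' this 2
    _ = _ := by rw [← ENNReal.rpow_natCast, ← ENNReal.rpow_mul]; norm_num

lemma norm_cexp_I_mul (x y : ℝ) : ‖Complex.exp (I * x * y)‖ₑ = 1 := by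
  rw [← ofReal_norm, Complex.norm_exp]; simp

lemma tonelli_aux {W : ℝ × ℝ → ℝ≥0∞} {h : ℤ → ℝ → ℝ × ℝ → ℝ≥0∞} {β : ℤ → ℝ × ℝ → ℝ≥0∞}
    (hWm : Measurable W) (hhm : ∀ ξ, Measurable (fun q : ℝ × (ℝ × ℝ) => h ξ q.1 q.2))
    (hβm : ∀ ξ, Measurable (β ξ)) (J : Set ℝ) (K : ℝ≥0∞)
    (hK : ∀ ξ z, ∫⁻ t in J, h ξ t z ^ 2 ≤ K * β ξ z) (hβ : ∀ z, ∑' ξ, β ξ z ≤ W z ^ 2) :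
    ∫⁻ t in J, ∑' ξ : ℤ, (∫⁻ z, W z) * ∫⁻ z, (W z)⁻¹ * h ξ t z ^ 2 ≤ K * (∫⁻ z, W z) ^ 2 := by
  have hm0 : ∀ ξ, Measurable fun q : ℝ × (ℝ × ℝ) => (W q.2)⁻¹ * h ξ q.1 q.2 ^ 2 := fun ξ =>
    (hWm.comp measurable_snd).inv.mul ((hhm ξ).pow_const 2)
  have hm : ∀ ξ, Measurable fun t => ∫⁻ z, (W z)⁻¹ * h ξ t z ^ 2 := fun ξ =>
    Measurable.lintegral_prod_right' (hm0 ξ)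
  have hsw : ∀ ξ, ∫⁻ t in J, ∫⁻ z, (W z)⁻¹ * h ξ t z ^ 2 =
      ∫⁻ z, (W z)⁻¹ * ∫⁻ t in J, h ξ t z ^ 2 := by
    intro ξ
    rw [lintegral_lintegral_swap (hm0 ξ).aemeasurable]
    refine lintegral_congr fun z => ?_
    rw [lintegral_const_mul]
    exact ((hhm ξ).comp measurable_prodMk_right).pow_const 2
  calc ∫⁻ t in J, ∑' ξ : ℤ, (∫⁻ z, W z) * ∫⁻ z, (W z)⁻¹ * h ξ t z ^ 2
      = ∑' ξ : ℤ, (∫⁻ z, W z) * ∫⁻ z, (W z)⁻¹ * ∫⁻ t in J, h ξ t z ^ 2 := by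
        rw [lintegral_tsum (fun ξ => ((hm ξ).const_mul _).aemeasurable)]
        congr 1; ext ξ
        rw [lintegral_const_mul _ (hm _), hsw]
    _ = (∫⁻ z, W z) * ∑' ξ : ℤ, ∫⁻ z, (W z)⁻¹ * ∫⁻ t in J, h ξ t z ^ 2 := ENNReal.tsum_mul_left
    _ ≤ (∫⁻ z, W z) * ∑' ξ : ℤ, ∫⁻ z, (W z)⁻¹ * (K * β ξ z) := by
        refine mul_le_mul_right (ENNReal.tsum_le_tsum fun ξ => lintegral_mono fun z => ?_) _
        exact mul_le_mul_right (hK ξ z) _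
    _ = (∫⁻ z, W z) * ∫⁻ z, (W z)⁻¹ * (K * ∑' ξ : ℤ, β ξ z) := by
        have hmb : ∀ ξ, AEMeasurable (fun z => (W z)⁻¹ * (K * β ξ z)) volume :=
          fun ξ => (hWm.inv.mul ((hβm ξ).const_mul _)).aemeasurable
        rw [← lintegral_tsum hmb]
        simp_rw [ENNReal.tsum_mul_left]
    _ ≤ (∫⁻ z, W z) * ∫⁻ z, K * W z := by
        refine mul_le_mul_right (lintegral_mono fun z => ?_) _
        calc (W z)⁻¹ * (K * ∑' ξ : ℤ, β ξ z) ≤ (W z)⁻¹ * (K * W z ^ 2) :=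
              mul_le_mul_right (mul_le_mul_right (hβ z) _) _
          _ = ((W z)⁻¹ * W z) * (K * W z) := by ring
          _ ≤ 1 * (K * W z) := mul_le_mul_left (ENNReal.inv_mul_le_one _) _
          _ = _ := one_mul _
    _ = K * (∫⁻ z, W z) ^ 2 := by
        rw [lintegral_const_mul _ hWm]; ring

lemma combine_aux {W : ℝ × ℝ → ℝ≥0∞} {h : ℤ → ℝ → ℝ × ℝ → ℝ≥0∞} {β : ℤ → ℝ × ℝ → ℝ≥0∞}
    (hWm : Measurable W) (hhm : ∀ ξ, Measurable (fun q : ℝ × (ℝ × ℝ) => h ξ q.1 q.2))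
    (hβm : ∀ ξ, Measurable (β ξ)) (J : Set ℝ) (K : ℝ≥0∞)
    (hK : ∀ ξ z, ∫⁻ t in J, h ξ t z ^ 2 ≤ K * β ξ z) (hβ : ∀ z, ∑' ξ, β ξ z ≤ W z ^ 2)
    (hW0 : ∀ ξ t z, W z = 0 → h ξ t z = 0) (hWt : ∀ z, W z ≠ ⊤) (X : ℝ → ℤ → ℝ≥0∞)
    (hX : ∀ᵐ t : ℝ, ∀ ξ : ℤ, X t ξ ≤ ∫⁻ z, h ξ t z) :
    ∫⁻ t in J, ∑' ξ : ℤ, X t ξ ^ 2 ≤ K * (∫⁻ z, W z) ^ 2 := by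
  refine le_trans ?_ (tonelli_aux hWm hhm hβm J K hK hβ)
  refine lintegral_mono_ae ?_
  filter_upwards [ae_restrict_of_ae hX] with t ht
  refine ENNReal.tsum_le_tsum fun ξ => ?_
  refine (pow_le_pow_left' (ht ξ) 2).trans ?_
  have hm : Measurable (h ξ t) := (hhm ξ).comp measurable_prodMk_left
  exact wCS volume hm hWm (hW0 ξ t) hWt

set_option maxHeartbeats 1000000 in
lemma master (p : ℝ → ℝ) (S1 S2 : Finset ℤ) (a : ℤ → ℤ → ℂ) (ha : ∀ k m, ‖a k m‖ ≤ 1)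
    (F G : ℝ → ℤ → ℂ) (hFm : ∀ k, Measurable fun σ => F σ k) (hGm : ∀ k, Measurable fun σ => G σ k)
    (hF0 : ∀ σ, ∀ k ∉ S1, F σ k = 0)
    (hFi : ∀ k, Integrable fun σ => F σ k) (hGi : ∀ k, Integrable fun σ => G σ k)
    (K : ℝ≥0∞) (J : Set ℝ)
    (hK : ∀ (ξ : ℤ) (b : ℤ → ℂ), (∀ m, ξ - m ∉ S1 → b m = 0) →
      ∫⁻ t in J, ‖∑ m ∈ S2, b m * Complex.exp (I * ((p ((ξ - m : ℤ)) + p m : ℝ) : ℂ) * t)‖ₑ ^ 2 ≤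
        K * ∑ m ∈ S2, ‖b m‖ₑ ^ 2)
    (u v : ℝ → ℤ → ℂ)
    (hu : ∀ᵐ t : ℝ, ∀ k : ℤ, u t k = ∫ σ : ℝ, Complex.exp (I * ((σ + p k : ℝ) : ℂ) * t) * F σ k)
    (hv : ∀ᵐ t : ℝ, ∀ k : ℤ, v t k = ∫ σ : ℝ, Complex.exp (I * ((σ + p k : ℝ) : ℂ) * t) * G σ k) :
    ∫⁻ t in J, ∑' ξ : ℤ, ‖∑ m ∈ S2, a (ξ - m) m * u t (ξ - m) * v t m‖ₑ ^ 2 ≤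
      K * ((∫⁻ σ, nrm S1 (F σ)) * (∫⁻ σ, nrm S2 (G σ))) ^ 2 := by
  set W : ℝ × ℝ → ℝ≥0∞ := fun z => nrm S1 (F z.1) * nrm S2 (G z.2) with hW
  set b : ℤ → ℝ × ℝ → ℤ → ℂ := fun ξ z m => a (ξ - m) m * F z.1 (ξ - m) * G z.2 m with hb
  set h : ℤ → ℝ → ℝ × ℝ → ℝ≥0∞ := fun ξ t z =>
    ‖∑ m ∈ S2, b ξ z m * Complex.exp (I * ((p ((ξ - m : ℤ)) + p m : ℝ) : ℂ) * t)‖ₑ with hh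
  have hWm : Measurable W :=
    ((measurable_nrm S1 hFm).comp measurable_fst).mul ((measurable_nrm S2 hGm).comp measurable_snd)
  have hWt : ∀ z, W z ≠ ⊤ := fun z => ENNReal.mul_ne_top (nrm_ne_top _ _) (nrm_ne_top _ _)
  have hbm : ∀ ξ m, Measurable fun z => b ξ z m := by
    intro ξ m
    exact (((hFm (ξ - m)).comp measurable_fst).const_mul _).mul ((hGm m).comp measurable_snd)
  have hhm : ∀ ξ, Measurable (fun q : ℝ × (ℝ × ℝ) => h ξ q.1 q.2) := by
    intro ξ
    refine Measurable.enorm ?_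
    refine Finset.measurable_fun_sum _ fun m _ => ?_
    refine ((hbm ξ m).comp measurable_snd).mul ?_
    have : Continuous fun q : ℝ × (ℝ × ℝ) =>
      Complex.exp (I * ((p ((ξ - m : ℤ)) + p m : ℝ) : ℂ) * q.1) := by fun_prop
    exact this.measurable
  have hW0 : ∀ ξ t z, W z = 0 → h ξ t z = 0 := by
    intro ξ t z hz
    have : ∀ m ∈ S2, b ξ z m = 0 := by
      intro m hm
      simp only [hb]
      rcases mul_eq_zero.1 hz with h1 | h1
      · have : F z.1 (ξ - m) = 0 := by
          by_cases hk : ξ - m ∈ S1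
          · have := le_nrm S1 (F z.1) hk
            rw [h1] at this
            simpa using this
          · exact hF0 _ _ hk
        simp [this]
      · have := le_nrm S2 (G z.2) hm
        rw [h1] at this
        have : G z.2 m = 0 := by simpa using this
        simp [this]
    simp only [hh]
    rw [Finset.sum_eq_zero (fun m hm => by rw [this m hm, zero_mul])]
    simp
  -- pointwise bound
  have hpt : ∀ᵐ t : ℝ, ∀ ξ : ℤ, ‖∑ m ∈ S2, a (ξ - m) m * u t (ξ - m) * v t m‖ₑ ≤ ∫⁻ z, h ξ t z := by
    filter_upwards [hu, hv] with t hut hvt ξ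
    have hi : ∀ m, Integrable (fun z : ℝ × ℝ => a (ξ - m) m * 
        ((Complex.exp (I * ((z.1 + p ((ξ - m : ℤ)) : ℝ) : ℂ) * t) * F z.1 (ξ - m)) *
          (Complex.exp (I * ((z.2 + p m : ℝ) : ℂ) * t) * G z.2 m))) := by
      intro m
      refine Integrable.const_mul ?_ _
      have hexp : ∀ (c : ℝ) (f : ℝ → ℂ), Integrable f →
          Integrable fun σ : ℝ => Complex.exp (I * ((σ + c : ℝ) : ℂ) * t) * f σ := by
        intro c f hf
        refine hf.bdd_mul (c := 1) (by fun_prop) (ae_of_all _ fun s => ?_)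
        rw [Complex.norm_exp]; simp
      exact (hexp _ _ (hFi (ξ - m))).mul_prod (hexp _ _ (hGi m))
    have e : ∑ m ∈ S2, a (ξ - m) m * u t (ξ - m) * v t m = ∫ z : ℝ × ℝ, 
        Complex.exp (I * ((z.1 + z.2 : ℝ) : ℂ) * t) * 
          ∑ m ∈ S2, b ξ z m * Complex.exp (I * ((p ((ξ - m : ℤ)) + p m : ℝ) : ℂ) * t) := by
      calc _ = ∑ m ∈ S2, ∫ z : ℝ × ℝ, a (ξ - m) m * 
            ((Complex.exp (I * ((z.1 + p ((ξ - m : ℤ)) : ℝ) : ℂ) * t) * F z.1 (ξ - m)) *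
            (Complex.exp (I * ((z.2 + p m : ℝ) : ℂ) * t) * G z.2 m)) := by
              refine Finset.sum_congr rfl fun m _ => ?_
              rw [integral_const_mul, Measure.volume_eq_prod, 
                integral_prod_mul (fun x : ℝ => Complex.exp (I * ((x + p ((ξ - m : ℤ)) : ℝ) : ℂ) * t) * F x (ξ - m)) 
                  (fun y : ℝ => Complex.exp (I * ((y + p m : ℝ) : ℂ) * t) * G y m),
                ← hut, ← hvt, mul_assoc]
        _ = _ := by
              rw [← integral_finsetSum _ (fun m _ => hi m)]
              congr 1; ext z
              rw [Finset.mul_sum]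
              refine Finset.sum_congr rfl fun m _ => ?_
              simp only [hb]
              have e1 : Complex.exp (I * ((z.1 + p ((ξ - m : ℤ)) : ℝ) : ℂ) * t) * 
                  Complex.exp (I * ((z.2 + p m : ℝ) : ℂ) * t) = 
                  Complex.exp (I * ((z.1 + z.2 : ℝ) : ℂ) * t) * 
                  Complex.exp (I * ((p ((ξ - m : ℤ)) + p m : ℝ) : ℂ) * t) := by
                rw [← Complex.exp_add, ← Complex.exp_add]; congr 1; push_cast; ring
              linear_combination (a (ξ - m) m * F z.1 (ξ - m) * G z.2 m) * e1
    rw [e]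
    refine (enorm_integral_le_lintegral_enorm _).trans (le_of_eq ?_)
    refine lintegral_congr fun z => ?_
    rw [enorm_mul, norm_cexp_I_mul, one_mul]
  have hWint : ∫⁻ z, W z = (∫⁻ σ, nrm S1 (F σ)) * (∫⁻ σ, nrm S2 (G σ)) := by
    rw [Measure.volume_eq_prod]
    exact lintegral_prod_mul (measurable_nrm S1 hFm).aemeasurable (measurable_nrm S2 hGm).aemeasurable
  have hsumb : ∀ z, ∑' ξ : ℤ, ∑ m ∈ S2, ‖b ξ z m‖ₑ ^ 2 ≤ W z ^ 2 := by
    intro z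
    have hF2 : ∀ m : ℤ, ∑' ξ : ℤ, ‖F z.1 (ξ - m)‖ₑ ^ 2 = nrm S1 (F z.1) ^ 2 := by
      intro m
      refine ((Equiv.subRight m).tsum_eq (fun k => ‖F z.1 k‖ₑ ^ 2)).trans ?_
      rw [nrm_sq]
      exact tsum_eq_sum fun k hk => by simp [hF0 _ k hk]
    calc ∑' ξ : ℤ, ∑ m ∈ S2, ‖b ξ z m‖ₑ ^ 2 
        ≤ ∑' ξ : ℤ, ∑ m ∈ S2, ‖F z.1 (ξ - m)‖ₑ ^ 2 * ‖G z.2 m‖ₑ ^ 2 := by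
          refine ENNReal.tsum_le_tsum fun ξ => Finset.sum_le_sum fun m _ => ?_
          rw [← mul_pow]
          refine pow_le_pow_left' ?_ 2
          simp only [hb, enorm_mul]
          have : ‖a (ξ - m) m‖ₑ ≤ 1 := by
            rw [← ofReal_norm]; exact ENNReal.ofReal_le_one.2 (ha _ _)
          calc _ ≤ 1 * ‖F z.1 (ξ - m)‖ₑ * ‖G z.2 m‖ₑ := by gcongr
            _ = _ := by rw [one_mul]
      _ = ∑ m ∈ S2, ∑' ξ : ℤ, ‖F z.1 (ξ - m)‖ₑ ^ 2 * ‖G z.2 m‖ₑ ^ 2 :=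
          Summable.tsum_finsetSum fun m _ => ENNReal.summable
      _ = W z ^ 2 := by
          simp_rw [ENNReal.tsum_mul_right, hF2, ← Finset.mul_sum]
          rw [← nrm_sq, ← mul_pow]
  have hβm : ∀ ξ, Measurable (fun z => ∑ m ∈ S2, ‖b ξ z m‖ₑ ^ 2) := fun ξ =>
    Finset.measurable_fun_sum _ fun m _ => (hbm ξ m).enorm.pow_const 2
  have hK' : ∀ ξ z, ∫⁻ t in J, h ξ t z ^ 2 ≤ K * ∑ m ∈ S2, ‖b ξ z m‖ₑ ^ 2 := by
    intro ξ z
    have hz : ∀ m, ξ - m ∉ S1 → b ξ z m = 0 := by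
      intro m hm
      have e0 : F z.1 (ξ - m) = 0 := hF0 _ _ hm
      show a (ξ - m) m * F z.1 (ξ - m) * G z.2 m = 0
      rw [e0, mul_zero, zero_mul]
    exact hK ξ (b ξ z) hz
  have := combine_aux hWm hhm hβm J K hK' hsumb hW0 hWt _ hpt
  rw [hWint] at this
  exact this

lemma lpSymb_zero (χ : ℝ → ℝ) (ξ : ℝ) : lpSymb χ 0 ξ = χ (2 * ξ) := by simp [lpSymb]

lemma lpSymb_of_ne (χ : ℝ → ℝ) {N : ℝ} (hN : N ≠ 0) (ξ : ℝ) :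
    lpSymb χ N ξ = χ (ξ / N) - χ (2 * ξ / N) := by simp [lpSymb, hN]

lemma lp_abs_le {χ : ℝ → ℝ} (hχ : CutoffFun χ) (N ξ : ℝ) : |lpSymb χ N ξ| ≤ 1 := by
  unfold lpSymb
  split_ifs
  · rw [abs_le]; exact ⟨by linarith [hχ.nonneg (2 * ξ)], hχ.le_one _⟩
  · rw [abs_le]
    constructor
    · linarith [hχ.nonneg (ξ / N), hχ.le_one (2 * ξ / N)]
    · linarith [hχ.nonneg (2 * ξ / N), hχ.le_one (ξ / N)]

lemma lp_cont {χ : ℝ → ℝ} (hχ : CutoffFun χ) (N : ℝ) : Continuous (lpSymb χ N) := by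
  have hc : Continuous χ := hχ.smooth.continuous
  unfold lpSymb
  split_ifs
  · fun_prop
  · fun_prop

lemma chi_zero {χ : ℝ → ℝ} (hχ : CutoffFun χ) {x : ℝ} (hx : 2 < |x|) : χ x = 0 := by
  by_contra h
  have := hχ.compact_supp x h
  have : |x| ≤ 2 := abs_le.2 this
  linarith

lemma chi_one {χ : ℝ → ℝ} (hχ : CutoffFun χ) {x : ℝ} (hx : |x| ≤ 1) : χ x = 1 :=
  hχ.eq_one x (abs_le.1 hx)

lemma lp_supp_pos {χ : ℝ → ℝ} (hχ : CutoffFun χ) {N ξ : ℝ} (hN : 0 < N)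
    (h : lpSymb χ N ξ ≠ 0) : N / 2 ≤ |ξ| ∧ |ξ| ≤ 2 * N := by
  rw [lpSymb_of_ne χ hN.ne'] at h
  constructor
  · by_contra hlt
    push Not at hlt
    apply h
    rw [chi_one hχ, chi_one hχ, sub_self]
    · rw [abs_div, abs_mul, abs_of_pos hN, div_le_one hN, abs_two]; linarith
    · rw [abs_div, abs_of_pos hN, div_le_one hN]; linarith
  · by_contra hlt
    push Not at hlt
    apply h
    rw [chi_zero hχ, chi_zero hχ, sub_self]
    · rw [abs_div, abs_mul, abs_of_pos hN, lt_div_iff₀ hN, abs_two]; linarith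
    · rw [abs_div, abs_of_pos hN, lt_div_iff₀ hN]; linarith

lemma lp_supp {χ : ℝ → ℝ} (hχ : CutoffFun χ) {L σ : ℝ} (hL : 0 ≤ L)
    (h : lpSymb χ L σ ≠ 0) : |σ| ≤ 2 * max L 1 := by
  rcases hL.eq_or_lt with h0 | h0
  · rw [← h0] at h ⊢
    rw [lpSymb_zero] at h
    have : |2 * σ| ≤ 2 := abs_le.2 (hχ.compact_supp _ h)
    rw [abs_mul, abs_two] at this
    have h1 : (1:ℝ) ≤ max 0 1 := le_max_right _ _
    linarith
  · have := (lp_supp_pos hχ h0 h).2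
    have h1 : L ≤ max L 1 := le_max_left _ _
    linarith

lemma lp_telescope (χ : ℝ → ℝ) (σ : ℝ) (n : ℕ) :
    lpSymb χ 0 σ + ∑ l ∈ Finset.range (n + 1), lpSymb χ ((2:ℝ) ^ l) σ = χ (σ / 2 ^ n) := by
  induction n with
  | zero => simp [lpSymb]
  | succ n ih =>
    rw [Finset.sum_range_succ, ← add_assoc, ih, lpSymb_of_ne χ (by positivity)]
    have : 2 * σ / 2 ^ (n + 1) = σ / 2 ^ n := by field_simp; ring
    rw [this]; ring

lemma lp_partition {χ : ℝ → ℝ} (hχ : CutoffFun χ) (σ : ℝ) :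
    1 ≤ ‖lpSymb χ 0 σ‖ₑ + ∑' l : ℕ, ‖lpSymb χ ((2:ℝ) ^ l) σ‖ₑ := by
  obtain ⟨n, hn⟩ := pow_unbounded_of_one_lt |σ| (one_lt_two)
  have e : lpSymb χ 0 σ + ∑ l ∈ Finset.range (n + 1), lpSymb χ ((2:ℝ) ^ l) σ = 1 := by
    rw [lp_telescope]
    apply chi_one hχ
    rw [abs_div, abs_of_pos (by positivity : (0:ℝ) < 2 ^ n), div_le_one (by positivity)]
    exact hn.le
  calc (1 : ℝ≥0∞) = ‖(1:ℝ)‖ₑ := by simp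
    _ ≤ ‖lpSymb χ 0 σ‖ₑ + ‖∑ l ∈ Finset.range (n + 1), lpSymb χ ((2:ℝ) ^ l) σ‖ₑ := by
        rw [← e]; exact enorm_add_le _ _
    _ ≤ ‖lpSymb χ 0 σ‖ₑ + ∑ l ∈ Finset.range (n + 1), ‖lpSymb χ ((2:ℝ) ^ l) σ‖ₑ := by
        gcongr; exact enorm_sum_le _ _
    _ ≤ _ := by
        gcongr; exact ENNReal.sum_le_tsum _

/-- The profile of `V` after removing the free evolution. -/
def prof (p : ℝ → ℝ) (V : ℝ → ℤ → ℂ) (σ : ℝ) (k : ℤ) : ℂ :=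
  ((2 * π)⁻¹ : ℝ) • FT (fun s => V s k) (σ + p k)

lemma FT_zero_fun (τ : ℝ) : FT (fun _ => 0) τ = 0 := by simp [FT]

lemma prof_zero (p : ℝ → ℝ) {V : ℝ → ℤ → ℂ} {k : ℤ} (h : ∀ t, V t k = 0) (σ : ℝ) :
    prof p V σ k = 0 := by
  simp [prof, h, FT_zero_fun]

lemma QL_zero (χ p : ℝ → ℝ) (L : ℝ) {V : ℝ → ℤ → ℂ} {k : ℤ} (h : ∀ t, V t k = 0) (t : ℝ) :
    QL χ p L V t k = 0 := by
  simp [QL, h, FT_zero_fun, IFT]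

lemma prof_cont (p : ℝ → ℝ) {V : ℝ → ℤ → ℂ} {k : ℤ} (h : Integrable fun t => V t k) :
    Continuous fun σ => prof p V σ k := by
  unfold prof
  have h1 : Continuous fun σ : ℝ => FT (fun s => V s k) (σ + p k) :=
    (continuous_FT h).comp (continuous_add_const (p k))
  exact h1.const_smul ((2 * π)⁻¹ : ℝ)

lemma perL {χ : ℝ → ℝ} (hχ : CutoffFun χ) (p : ℝ → ℝ) (S : Finset ℤ) (V : ℝ → ℤ → ℂ)
    (hVi : ∀ k, Integrable fun t => V t k) (hV0 : ∀ t, ∀ k ∉ S, V t k = 0) {L : ℝ} (hL : 0 ≤ L) :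
    ∫⁻ σ, ‖lpSymb χ L σ‖ₑ * nrm S (prof p V σ) ≤
      ENNReal.ofReal ((max L 1) ^ ((1:ℝ)/2) * L2full (QL χ p L V)) := by
  have hR : 0 < max L 1 := lt_of_lt_of_le one_pos (le_max_right _ _)
  set R := max L 1 with hRdef
  have hFm : ∀ k, Measurable fun σ => prof p V σ k := fun k => (prof_cont p (hVi k)).measurable
  set H : ℤ → ℝ → ℂ := fun k τ => (lpSymb χ L (τ - p k) : ℂ) * FT (fun s => V s k) τ with hH
  have hHc : ∀ k, Continuous (H k) := fun k =>
    (continuous_ofReal.comp ((lp_cont hχ L).comp (by fun_prop))).mul (continuous_FT (hVi k))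
  have hHs : ∀ k, HasCompactSupport (H k) := by
    intro k
    refine HasCompactSupport.intro (isCompact_Icc (a := p k - 2 * R) (b := p k + 2 * R)) ?_
    intro τ hτ
    have : lpSymb χ L (τ - p k) = 0 := by
      by_contra h
      have := abs_le.1 (lp_supp hχ hL h)
      apply hτ
      constructor <;> linarith [this.1, this.2]
    simp [hH, this]
  have hHi : ∀ k, Integrable (H k) := fun k => (hHc k).integrable_of_hasCompactSupport (hHs k)
  have hH2 : ∀ k, MemLp (H k) 2 := fun k => (hHc k).memLp_of_hasCompactSupport (hHs k)
  have hQ : ∀ k t, QL χ p L V t k = IFT (H k) t := fun k t => rfl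
  have hQc : ∀ k, Continuous fun t => QL χ p L V t k := fun k => continuous_IFT (hHi k)
  have hpl : ∀ k, ∫⁻ τ, ‖H k τ‖ₑ ^ 2 = ENNReal.ofReal (2 * π) * ∫⁻ t, ‖QL χ p L V t k‖ₑ ^ 2 :=
    fun k => IFT_plancherel (hHi k) (hH2 k)
  have hfin : ∀ k, ∫⁻ t, ‖QL χ p L V t k‖ₑ ^ 2 < ⊤ := by
    intro k
    have h1 : ∫⁻ τ, ‖H k τ‖ₑ ^ 2 < ⊤ := by
      have := lintegral_rpow_enorm_lt_top_of_eLpNorm_lt_top (p := 2) (by norm_num) (by norm_num) (hH2 k).2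
      simpa using this
    rw [hpl k] at h1
    by_contra h2
    rw [not_lt, top_le_iff] at h2
    rw [h2, ENNReal.mul_top (by simp [Real.pi_pos])] at h1
    exact lt_irrefl _ h1
  have hl2 : ∀ t, l2sq (QL χ p L V t) = ∑ k ∈ S, ‖QL χ p L V t k‖ ^ 2 := by
    intro t
    refine tsum_eq_sum fun k hk => ?_
    rw [QL_zero χ p L (fun t => hV0 t k hk)]; simp
  have hl2e : ∀ t, ENNReal.ofReal (l2sq (QL χ p L V t)) = ∑ k ∈ S, ‖QL χ p L V t k‖ₑ ^ 2 := by
    intro t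
    rw [hl2, ENNReal.ofReal_sum_of_nonneg (fun _ _ => by positivity)]
    refine Finset.sum_congr rfl fun k _ => ?_
    rw [ENNReal.ofReal_pow (norm_nonneg _), ofReal_norm]
  have hl2n : ∀ t, 0 ≤ l2sq (QL χ p L V t) := fun t => by rw [hl2]; positivity
  have hlint : ∫⁻ t, ENNReal.ofReal (l2sq (QL χ p L V t)) =
      ∑ k ∈ S, ∫⁻ t, ‖QL χ p L V t k‖ₑ ^ 2 := by
    simp_rw [hl2e]
    exact lintegral_finsetSum _ fun k _ => (hQc k).measurable.enorm.pow_const 2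
  have hwZ : Integrable fun t => l2sq (QL χ p L V t) := by
    constructor
    · simp_rw [hl2]
      have : Continuous fun t => ∑ k ∈ S, ‖QL χ p L V t k‖ ^ 2 :=
        continuous_finsetSum _ fun k _ => ((hQc k).norm.pow 2)
      exact this.aestronglyMeasurable
    · rw [hasFiniteIntegral_iff_ofReal (ae_of_all _ hl2n), hlint]
      exact ENNReal.sum_lt_top.2 fun k _ => hfin k
  have hI : ENNReal.ofReal (∫ t, l2sq (QL χ p L V t)) = ∑ k ∈ S, ∫⁻ t, ‖QL χ p L V t k‖ₑ ^ 2 := by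
    rw [ofReal_integral_eq_lintegral_ofReal hwZ (ae_of_all _ hl2n), hlint]
  have hI0 : 0 ≤ ∫ t, l2sq (QL χ p L V t) := integral_nonneg hl2n
  -- Cauchy-Schwarz
  have hm : Measurable fun σ => ‖lpSymb χ L σ‖ₑ * nrm S (prof p V σ) :=
    (lp_cont hχ L).measurable.enorm.mul (measurable_nrm S hFm)
  have hz : ∀ σ, σ ∉ Icc (-(2 * R)) (2 * R) → ‖lpSymb χ L σ‖ₑ * nrm S (prof p V σ) = 0 := by
    intro σ hσ
    have : lpSymb χ L σ = 0 := by
      by_contra h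
      exact hσ (abs_le.1 (lp_supp hχ hL h))
    simp [this]
  have cs := wCS volume (W := (Icc (-(2 * R)) (2 * R)).indicator 1) hm
    (measurable_one.indicator measurableSet_Icc)
    (fun σ h0 => hz σ (fun hσ => by simp [hσ] at h0)) 
    (fun σ => by by_cases hσ : σ ∈ Icc (-(2 * R)) (2 * R) <;> simp [hσ])
  have e1 : ∀ σ, ((Icc (-(2 * R)) (2 * R)).indicator (1 : ℝ → ℝ≥0∞) σ)⁻¹ *
      (‖lpSymb χ L σ‖ₑ * nrm S (prof p V σ)) ^ 2 =
      ∑ k ∈ S, ENNReal.ofReal ((2 * π)⁻¹) ^ 2 * ‖H k (σ + p k)‖ₑ ^ 2 := by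
    intro σ
    have e2 : (‖lpSymb χ L σ‖ₑ * nrm S (prof p V σ)) ^ 2 =
      ∑ k ∈ S, ENNReal.ofReal ((2 * π)⁻¹) ^ 2 * ‖H k (σ + p k)‖ₑ ^ 2 := by
      rw [mul_pow, nrm_sq, Finset.mul_sum]
      refine Finset.sum_congr rfl fun k _ => ?_
      simp only [hH, prof, add_sub_cancel_right, enorm_mul, enorm_smul]
      have : ‖((lpSymb χ L σ : ℝ) : ℂ)‖ₑ = ‖lpSymb χ L σ‖ₑ := by
        rw [← ofReal_norm, ← ofReal_norm, Complex.norm_real]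
      rw [this, Real.enorm_of_nonneg (by positivity : 0 ≤ (2 * π)⁻¹)]
      ring
    by_cases hσ : σ ∈ Icc (-(2 * R)) (2 * R)
    · rw [← e2, indicator_of_mem hσ]; simp
    · rw [← e2, hz σ hσ]; simp
  rw [lintegral_congr e1, lintegral_indicator_one measurableSet_Icc, Real.volume_Icc,
    lintegral_finsetSum _ (fun k _ => by
      exact (((hHc k).measurable.comp (measurable_add_const _)).enorm.pow_const 2).const_mul _)] at cs
  have e3 : ∑ k ∈ S, ∫⁻ σ, ENNReal.ofReal ((2 * π)⁻¹) ^ 2 * ‖H k (σ + p k)‖ₑ ^ 2 =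
      ENNReal.ofReal ((2 * π)⁻¹ * ∫ t, l2sq (QL χ p L V t)) := by
    rw [ENNReal.ofReal_mul (by positivity), hI, Finset.mul_sum]
    refine Finset.sum_congr rfl fun k _ => ?_
    have hmk : Measurable fun σ => ‖H k (σ + p k)‖ₑ ^ 2 :=
      ((hHc k).measurable.comp (measurable_add_const _)).enorm.pow_const 2
    rw [lintegral_const_mul _ hmk,
      lintegral_add_right_eq_self (fun τ => ‖H k τ‖ₑ ^ 2) (p k), hpl k, ← mul_assoc]
    congr 1
    rw [← ENNReal.ofReal_pow (by positivity), ← ENNReal.ofReal_mul (by positivity)]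
    congr 1
    field_simp
  rw [e3, ← ENNReal.ofReal_mul (by linarith)] at cs
  refine (ENNReal.pow_le_pow_left_iff two_ne_zero).1 (cs.trans ?_)
  rw [← ENNReal.ofReal_pow (by unfold L2full; positivity)]
  refine ENNReal.ofReal_le_ofReal ?_
  have e4 : ((R ^ ((1:ℝ)/2)) * L2full (QL χ p L V)) ^ 2 = R * ∫ t, l2sq (QL χ p L V t) := by
    unfold L2full
    rw [mul_pow, ← Real.rpow_natCast, ← Real.rpow_natCast, ← Real.rpow_mul hR.le, ← Real.rpow_mul hI0]
    norm_num
  rw [e4]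
  have hpi : (2 * π)⁻¹ * 4 ≤ 1 := by
    rw [inv_mul_le_iff₀ (by positivity)]; linarith [Real.pi_gt_three]
  have : 0 ≤ R * ∫ t, l2sq (QL χ p L V t) := by positivity
  nlinarith

lemma transf {χ : ℝ → ℝ} (hχ : CutoffFun χ) (p : ℝ → ℝ) (S : Finset ℤ) (V : ℝ → ℤ → ℂ)
    (hVi : ∀ k, Integrable fun t => V t k) (hV0 : ∀ t, ∀ k ∉ S, V t k = 0)
    (hs : Summable (fun l : ℕ => ((2:ℝ) ^ l) ^ ((1:ℝ)/2) * L2full (QL χ p ((2:ℝ) ^ l) V))) :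
    ∫⁻ σ, nrm S (prof p V σ) ≤ ENNReal.ofReal (Xhalf χ p V) := by
  have hFm : ∀ k, Measurable fun σ => prof p V σ k := fun k => (prof_cont p (hVi k)).measurable
  have hn : ∀ L, 0 ≤ L2full (QL χ p L V) := fun L => by
    unfold L2full
    exact Real.rpow_nonneg (integral_nonneg fun t => tsum_nonneg fun _ => by positivity) _
  have hm : ∀ L, Measurable fun σ => ‖lpSymb χ L σ‖ₑ * nrm S (prof p V σ) := fun L =>
    (lp_cont hχ L).measurable.enorm.mul (measurable_nrm S hFm)
  calc ∫⁻ σ, nrm S (prof p V σ)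
      ≤ ∫⁻ σ, (‖lpSymb χ 0 σ‖ₑ * nrm S (prof p V σ) +
          ∑' l : ℕ, ‖lpSymb χ ((2:ℝ) ^ l) σ‖ₑ * nrm S (prof p V σ)) := by
        refine lintegral_mono fun σ => ?_
        rw [ENNReal.tsum_mul_right, ← add_mul]
        calc nrm S (prof p V σ) = 1 * nrm S (prof p V σ) := (one_mul _).symm
          _ ≤ _ := by
            gcongr
            exact lp_partition hχ σ
    _ = (∫⁻ σ, ‖lpSymb χ 0 σ‖ₑ * nrm S (prof p V σ)) +
          ∑' l : ℕ, ∫⁻ σ, ‖lpSymb χ ((2:ℝ) ^ l) σ‖ₑ * nrm S (prof p V σ) := by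
        rw [lintegral_add_left (hm 0), lintegral_tsum fun l => (hm _).aemeasurable]
    _ ≤ ENNReal.ofReal (L2full (QL χ p 0 V)) +
          ∑' l : ℕ, ENNReal.ofReal (((2:ℝ) ^ l) ^ ((1:ℝ)/2) * L2full (QL χ p ((2:ℝ) ^ l) V)) := by
        refine add_le_add ?_ (ENNReal.tsum_le_tsum fun l => ?_)
        · have := perL hχ p S V hVi hV0 (le_refl (0:ℝ))
          simpa using this
        · have := perL hχ p S V hVi hV0 (L := (2:ℝ) ^ l) (by positivity)
          rwa [max_eq_left (one_le_pow₀ (by norm_num))] at this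
    _ = ENNReal.ofReal (Xhalf χ p V) := by
        have hn' : ∀ l : ℕ, 0 ≤ ((2:ℝ) ^ l) ^ ((1:ℝ)/2) * L2full (QL χ p ((2:ℝ) ^ l) V) :=
          fun l => mul_nonneg (by positivity) (hn _)
        rw [Xhalf, ENNReal.ofReal_add (hn 0) (tsum_nonneg hn'), ENNReal.ofReal_tsum_of_nonneg hn' hs]

lemma prof_int {p : ℝ → ℝ} (S : Finset ℤ) (V : ℝ → ℤ → ℂ)
    (hVi : ∀ k, Integrable fun t => V t k) (hV0 : ∀ t, ∀ k ∉ S, V t k = 0)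
    (hfin : ∫⁻ σ, nrm S (prof p V σ) < ⊤) (k : ℤ) : Integrable fun σ => prof p V σ k := by
  refine ⟨(prof_cont p (hVi k)).aestronglyMeasurable, ?_⟩
  refine lt_of_le_of_lt (lintegral_mono fun σ => ?_) hfin
  by_cases hk : k ∈ S
  · exact le_nrm S _ hk
  · simp only [prof_zero p (fun t => hV0 t k hk)]; simp

lemma prof_inv {p : ℝ → ℝ} {V : ℝ → ℤ → ℂ} (hVi : ∀ k, Integrable fun t => V t k)
    (hF : ∀ k, Integrable fun σ => prof p V σ k) :
    ∀ᵐ t : ℝ, ∀ k : ℤ, V t k =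
      ∫ σ : ℝ, Complex.exp (I * ((σ + p k : ℝ) : ℂ) * t) * prof p V σ k := by
  rw [ae_all_iff]
  intro k
  have h1 : Integrable (FT fun s => V s k) := by
    have h2 := (hF k).comp_sub_right (p k)
    have h3 := h2.smul (2 * π : ℝ)
    refine h3.congr (ae_of_all _ fun τ => ?_)
    simp only [prof, Pi.smul_apply, sub_add_cancel, smul_smul]
    rw [mul_inv_cancel₀ (by positivity), one_smul]
  filter_upwards [IFT_FT (hVi k) h1] with t ht
  rw [ht, IFT, ← integral_add_right_eq_self _ (p k), ← integral_smul]
  congr 1; ext σ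
  simp only [prof]
  rw [mul_smul_comm]

lemma FT_const_mul (c : ℂ) (g : ℝ → ℂ) (τ : ℝ) : FT (fun s => c * g s) τ = c * FT g τ := by
  unfold FT
  rw [← integral_const_mul]
  congr 1; ext t; ring

lemma QL_PN (χ p : ℝ → ℝ) (L N : ℝ) (U : ℝ → ℤ → ℂ) (t : ℝ) (k : ℤ) :
    QL χ p L (fun t => PN χ N (U t)) t k = (lpSymb χ N k : ℂ) * QL χ p L U t k := by
  unfold QL PN IFT
  simp_rw [FT_const_mul]
  rw [mul_smul_comm, ← integral_const_mul]
  congr 2; ext τ; ring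

lemma L2full_PN {χ : ℝ → ℝ} (hχ : CutoffFun χ) (p : ℝ → ℝ) (L N : ℝ) (U : ℝ → ℤ → ℂ)
    (hs : ∀ t : ℝ, Summable fun ξ : ℤ => ‖QL χ p L U t ξ‖ ^ 2)
    (hi : Integrable fun t : ℝ => l2sq (QL χ p L U t)) :
    L2full (QL χ p L (fun t => PN χ N (U t))) ≤ L2full (QL χ p L U) := by
  unfold L2full
  refine Real.rpow_le_rpow (integral_nonneg fun t => tsum_nonneg fun _ => by positivity) ?_ (by norm_num)
  refine integral_mono_of_nonneg (ae_of_all _ fun t => tsum_nonneg fun _ => by positivity) hi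
    (ae_of_all _ fun t => ?_)
  have hle : ∀ k : ℤ, ‖QL χ p L (fun t => PN χ N (U t)) t k‖ ^ 2 ≤ ‖QL χ p L U t k‖ ^ 2 := by
    intro k
    rw [QL_PN, norm_mul, Complex.norm_real]
    refine pow_le_pow_left₀ (by positivity) ?_ 2
    exact mul_le_of_le_one_left (norm_nonneg _) (lp_abs_le hχ _ _)
  exact Summable.tsum_le_tsum hle (Summable.of_nonneg_of_le (fun _ => by positivity) hle (hs t)) (hs t)

lemma summable_PN {χ : ℝ → ℝ} (hχ : CutoffFun χ) (p : ℝ → ℝ) (N : ℝ) {U : ℝ → ℤ → ℂ}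
    (hU : MemX χ p U) :
    Summable (fun l : ℕ => ((2:ℝ) ^ l) ^ ((1:ℝ)/2) *
      L2full (QL χ p ((2:ℝ) ^ l) (fun t => PN χ N (U t)))) := by
  obtain ⟨-, -, -, h4, -, h6, h7⟩ := hU
  refine Summable.of_nonneg_of_le (fun l => ?_) (fun l => ?_) h7
  · refine mul_nonneg (by positivity) ?_
    unfold L2full
    exact Real.rpow_nonneg (integral_nonneg fun t => tsum_nonneg fun _ => by positivity) _
  · exact mul_le_mul_of_nonneg_left (L2full_PN hχ p _ N U (h4 l) (h6 l)) (by positivity)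

lemma PN_int (χ p : ℝ → ℝ) (N : ℝ) {U : ℝ → ℤ → ℂ} (hU : MemX χ p U) (k : ℤ) :
    Integrable fun t => PN χ N (U t) k := by
  unfold PN
  exact (hU.2.1 k).const_mul _

open Classical in
/-- The frequency support of `P_{2^n}`. -/
def supp (χ : ℝ → ℝ) (n : ℕ) : Finset ℤ :=
  (Finset.Icc (-(2 ^ (n + 1) : ℤ)) (2 ^ (n + 1))).filter fun k => lpSymb χ ((2:ℝ) ^ n) k ≠ 0

lemma mem_supp {χ : ℝ → ℝ} (hχ : CutoffFun χ) (n : ℕ) (k : ℤ) :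
    k ∈ supp χ n ↔ lpSymb χ ((2:ℝ) ^ n) k ≠ 0 := by
  unfold supp
  rw [Finset.mem_filter, Finset.mem_Icc]
  refine ⟨fun h => h.2, fun h => ⟨?_, h⟩⟩
  have h1 := (lp_supp_pos hχ (by positivity) h).2
  rw [abs_le] at h1
  constructor
  · have : (-(2 ^ (n + 1) : ℤ) : ℝ) ≤ (k : ℝ) := by push_cast; rw [pow_succ]; linarith [h1.1]
    exact_mod_cast this
  · have : (k : ℝ) ≤ ((2 ^ (n + 1) : ℤ) : ℝ) := by push_cast; rw [pow_succ]; linarith [h1.2]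
    exact_mod_cast this

lemma card_supp (χ : ℝ → ℝ) (n : ℕ) : ((supp χ n).card : ℝ) ≤ 5 * 2 ^ n := by
  have h : (supp χ n).card ≤ (Finset.Icc (-(2 ^ (n + 1) : ℤ)) (2 ^ (n + 1))).card := by
    unfold supp; exact Finset.card_filter_le _ _
  rw [Int.card_Icc] at h
  have h1 : ((supp χ n).card : ℤ) ≤ 2 ^ (n + 1) + 1 - -(2 ^ (n + 1)) := by
    have h0 : (0:ℤ) ≤ 2 ^ (n + 1) + 1 - -(2 ^ (n + 1)) := by
      have : (0:ℤ) < 2 ^ (n + 1) := by positivity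
      linarith
    omega
  have h2 : ((supp χ n).card : ℝ) ≤ 2 ^ (n + 1) + 1 - -(2 ^ (n + 1)) := by exact_mod_cast h1
  have h3 : (1:ℝ) ≤ 2 ^ n := one_le_pow₀ (by norm_num)
  rw [pow_succ] at h2
  linarith

lemma trivial_bound (S : Finset ℤ) (ω : ℤ → ℝ) (b : ℤ → ℂ) (A B : ℝ) :
    ∫⁻ t in Ioo A B, ‖∑ m ∈ S, b m * Complex.exp (I * (ω m : ℂ) * (t : ℝ))‖ₑ ^ 2 ≤
      ENNReal.ofReal (S.card * (B - A)) * ∑ m ∈ S, ‖b m‖ₑ ^ 2 := by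
  have hpt : ∀ t : ℝ, ‖∑ m ∈ S, b m * Complex.exp (I * (ω m : ℂ) * t)‖ₑ ^ 2 ≤
      ENNReal.ofReal S.card * ∑ m ∈ S, ‖b m‖ₑ ^ 2 := by
    intro t
    have h1 : ‖∑ m ∈ S, b m * Complex.exp (I * (ω m : ℂ) * t)‖ ≤ ∑ m ∈ S, ‖b m‖ := by
      refine (norm_sum_le _ _).trans (le_of_eq (Finset.sum_congr rfl fun m _ => ?_))
      rw [norm_mul, Complex.norm_exp]; simp
    have h2 : ‖∑ m ∈ S, b m * Complex.exp (I * (ω m : ℂ) * t)‖ ^ 2 ≤ S.card * ∑ m ∈ S, ‖b m‖ ^ 2 :=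
      (pow_le_pow_left₀ (norm_nonneg _) h1 2).trans sq_sum_le_card_mul_sum_sq
    have h3 := ENNReal.ofReal_le_ofReal h2
    rw [ENNReal.ofReal_pow (norm_nonneg _), ofReal_norm, ENNReal.ofReal_mul (by positivity),
      ENNReal.ofReal_sum_of_nonneg (fun _ _ => by positivity)] at h3
    refine h3.trans (le_of_eq ?_)
    congr 1
    refine Finset.sum_congr rfl fun m _ => ?_
    rw [ENNReal.ofReal_pow (norm_nonneg _), ofReal_norm]
  refine (lintegral_mono hpt).trans (le_of_eq ?_)
  rw [lintegral_const, Measure.restrict_apply_univ, Real.volume_Ioo, ENNReal.ofReal_mul (by positivity)]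
  ring

lemma min_le_rpow {x θ : ℝ} (hx : 0 < x) (h0 : 0 ≤ θ) (h1 : θ ≤ 1) : min 1 x ≤ x ^ θ := by
  rcases le_total x 1 with h | h
  · rw [min_eq_right h]
    calc x = x ^ (1:ℝ) := (Real.rpow_one x).symm
      _ ≤ x ^ θ := Real.rpow_le_rpow_of_exponent_ge hx h h1
  · rw [min_eq_left h]; exact Real.one_le_rpow h h0

lemma Lam_eq (a : ℝ → ℝ → ℂ) (u v : ℤ → ℂ) (S : Finset ℤ) (hv : ∀ k ∉ S, v k = 0) (ξ : ℤ) :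
    Lam a u v ξ = ∑ m ∈ S, a ((ξ - m : ℤ)) m * u (ξ - m) * v m := by
  unfold Lam
  rw [← (Equiv.subLeft ξ).tsum_eq]
  have : ∀ m : ℤ, a (((Equiv.subLeft ξ) m : ℤ) : ℝ) ((ξ : ℝ) - (((Equiv.subLeft ξ) m : ℤ) : ℝ)) *
      u ((Equiv.subLeft ξ) m) * v (ξ - (Equiv.subLeft ξ) m) =
      a ((ξ - m : ℤ)) m * u (ξ - m) * v m := by
    intro m
    simp only [Equiv.subLeft_apply, sub_sub_cancel]
    congr 3
    push_cast; ring
  simp_rw [this]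
  exact tsum_eq_sum fun m hm => by rw [hv m hm, mul_zero]

lemma Lam_swap (a : ℝ → ℝ → ℂ) (u v : ℤ → ℂ) : Lam a u v = Lam (fun x y => a y x) v u := by
  ext ξ
  unfold Lam
  rw [← (Equiv.subLeft ξ).tsum_eq]
  congr 1; ext m
  simp only [Equiv.subLeft_apply, sub_sub_cancel]
  have : (ξ : ℝ) - ((ξ - m : ℤ) : ℝ) = m := by push_cast; ring
  rw [this]; push_cast; ring

lemma ofReal_l2sq_le (v : ℤ → ℂ) : ENNReal.ofReal (l2sq v) ≤ ∑' ξ, ‖v ξ‖ₑ ^ 2 := by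
  unfold l2sq
  by_cases h : Summable fun ξ => ‖v ξ‖ ^ 2
  · rw [ENNReal.ofReal_tsum_of_nonneg (fun _ => by positivity) h]
    refine le_of_eq (tsum_congr fun ξ => ?_)
    rw [ENNReal.ofReal_pow (norm_nonneg _), ofReal_norm]
  · rw [tsum_eq_zero_of_not_summable h]; simp

lemma integral_l2sq_le (J : Set ℝ) (V : ℝ → ℤ → ℂ) {D : ℝ} (hD : 0 ≤ D)
    (h : ∫⁻ t in J, ∑' ξ, ‖V t ξ‖ₑ ^ 2 ≤ ENNReal.ofReal D) : ∫ t in J, l2sq (V t) ≤ D := by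
  by_cases hi : Integrable (fun t => l2sq (V t)) (volume.restrict J)
  · rw [← ENNReal.ofReal_le_ofReal_iff hD, ofReal_integral_eq_lintegral_ofReal hi
      (ae_of_all _ fun t => tsum_nonneg fun _ => by positivity)]
    exact (lintegral_mono fun t => ofReal_l2sq_le (V t)).trans h
  · rw [integral_undef hi]; exact hD

lemma Xhalf_nonneg (χ p : ℝ → ℝ) (V : ℝ → ℤ → ℂ) : 0 ≤ Xhalf χ p V := by
  have hn : ∀ L, 0 ≤ L2full (QL χ p L V) := fun L => by
    unfold L2full
    exact Real.rpow_nonneg (integral_nonneg fun t => tsum_nonneg fun _ => by positivity) _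
  unfold Xhalf
  exact add_nonneg (hn 0) (tsum_nonneg fun l => mul_nonneg (by positivity) (hn _))

lemma core (α ξ₀ c₀ C₀ : ℝ) (hα : α ∈ Set.Icc (1:ℝ) 2)
    (p : ℝ → ℝ) (hp : Hyp1 α ξ₀ c₀ C₀ p) (χ : ℝ → ℝ) (hχ : CutoffFun χ) :
    ∃ K₀ : ℝ, 1 ≤ K₀ ∧ ∃ C : ℝ, 0 < C ∧
      ∀ (T : ℝ), 0 < T → T < 1 →
      ∀ (n₁ n₂ : ℕ),
      ∀ (a : ℝ → ℝ → ℂ), (∀ x y : ℝ, ‖a x y‖ ≤ 1) →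
      ∀ (U₁ U₂ : ℝ → ℤ → ℂ), MemX χ p U₁ → MemX χ p U₂ →
        K₀ * (2:ℝ) ^ n₂ ≤ (2:ℝ) ^ n₁ →
      ∀ θ : ℝ, θ ∈ Set.Icc (0:ℝ) 1 →
      ∀ (A B : ℝ), B - A ≤ ((2:ℝ) ^ n₁)⁻¹ * T →
        L2normOn (Set.Ioo A B)
            (fun t => Lam a (PN χ ((2:ℝ) ^ n₁) (U₁ t)) (PN χ ((2:ℝ) ^ n₂) (U₂ t))) ≤
          C * T ^ (θ/2) * ((2:ℝ) ^ n₂) ^ (θ/2) *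
            ((2:ℝ) ^ n₁) ^ (-(1:ℝ)/2) *
            Xhalf χ p (fun t => PN χ ((2:ℝ) ^ n₁) (U₁ t)) *
            Xhalf χ p (fun t => PN χ ((2:ℝ) ^ n₂) (U₂ t)) := by
  obtain ⟨K₀, hK₀, κ, hκ, hsep⟩ := phase_sep hα hp
  obtain ⟨G, hG, hsieve⟩ := sieve hκ
  refine ⟨K₀, hK₀, (G + 5) ^ ((1:ℝ)/2), by positivity, ?_⟩
  intro T hT0 hT1 n₁ n₂ a ha U₁ U₂ hU₁ hU₂ hKN θ hθ A B hAB
  have hN : (0:ℝ) < 2 ^ n₁ := by positivity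
  have hM : (1:ℝ) ≤ 2 ^ n₂ := one_le_pow₀ (by norm_num)
  have hmem1 := mem_supp hχ n₁
  have hmem2 := mem_supp hχ n₂
  have hcard := card_supp χ n₂
  have hlo1 : ∀ k : ℤ, k ∈ supp χ n₁ → (2:ℝ) ^ n₁ / 2 ≤ |(k:ℝ)| := fun k hk =>
    (lp_supp_pos hχ hN ((hmem1 k).1 hk)).1
  have hhi2 : ∀ k : ℤ, k ∈ supp χ n₂ → |(k:ℝ)| ≤ 2 * (2:ℝ) ^ n₂ := fun k hk =>
    (lp_supp_pos hχ (by positivity) ((hmem2 k).1 hk)).2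
  set N : ℝ := 2 ^ n₁ with hNdef
  set M : ℝ := 2 ^ n₂ with hMdef
  set S1 := supp χ n₁ with hS1
  set S2 := supp χ n₂ with hS2
  set V₁ : ℝ → ℤ → ℂ := fun t => PN χ N (U₁ t) with hV₁
  set V₂ : ℝ → ℤ → ℂ := fun t => PN χ M (U₂ t) with hV₂
  have hM0 : 0 < M := by linarith
  have hx : 0 < T * M := by positivity
  -- kernel bound
  have hK : ∀ (ξ : ℤ) (b : ℤ → ℂ), (∀ m, ξ - m ∉ S1 → b m = 0) →
      ∫⁻ t in Ioo A B,
        ‖∑ m ∈ S2, b m * Complex.exp (I * ((p ((ξ - m : ℤ)) + p m : ℝ) : ℂ) * t)‖ₑ ^ 2 ≤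
        ENNReal.ofReal ((G + 5) / N * (T * M) ^ θ) * ∑ m ∈ S2, ‖b m‖ₑ ^ 2 := by
    intro ξ b hb
    have hmin := min_le_rpow hx hθ.1 hθ.2
    have hGN : 0 < (G + 5) / N := by positivity
    rcases le_total 1 (T * M) with h1 | h1
    · rw [min_eq_left h1] at hmin
      classical
      have hz : ∀ m ∈ S2, m ∉ S2.filter (fun m => ξ - m ∈ S1) → b m = 0 := by
        intro m hm hm'
        apply hb
        intro h; exact hm' (Finset.mem_filter.2 ⟨hm, h⟩)
      have e1 : ∀ t : ℝ, 
          ∑ m ∈ S2, b m * Complex.exp (I * ((p ((ξ - m : ℤ)) + p m : ℝ) : ℂ) * t) =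
          ∑ m ∈ S2.filter (fun m => ξ - m ∈ S1),
            b m * Complex.exp (I * ((p ((ξ - m : ℤ)) + p m : ℝ) : ℂ) * t) := by
        intro t
        refine (Finset.sum_subset (Finset.filter_subset _ _) fun m hm hm' => ?_).symm
        rw [hz m hm hm', zero_mul]
      simp_rw [e1]
      have hs := hsieve N hN (S2.filter (fun m => ξ - m ∈ S1)) (fun m => p ((ξ - m : ℤ)) + p m) b A B
        ?_ ?_
      · refine hs.trans ?_
        refine mul_le_mul' (ENNReal.ofReal_le_ofReal ?_)
          (Finset.sum_le_sum_of_subset (Finset.filter_subset _ _))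
        calc G / N ≤ (G + 5) / N := by gcongr; linarith
          _ = (G + 5) / N * 1 := (mul_one _).symm
          _ ≤ _ := by gcongr
      · intro m hm m' hm'
        rw [Finset.mem_filter] at hm hm'
        refine hsep N M hM hKN _ _ _ _ ?_ (hlo1 _ hm.2) (hlo1 _ hm'.2) (hhi2 _ hm.1) (hhi2 _ hm'.1)
        push_cast; ring
      · refine hAB.trans ?_
        exact mul_le_of_le_one_right (by positivity) hT1.le
    · rw [min_eq_right h1] at hmin
      refine (trivial_bound S2 (fun m => p ((ξ - m : ℤ)) + p m) b A B).trans ?_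
      refine mul_le_mul' (ENNReal.ofReal_le_ofReal ?_) le_rfl
      calc (S2.card : ℝ) * (B - A) ≤ S2.card * (N⁻¹ * T) := by gcongr
        _ ≤ (5 * M) * (N⁻¹ * T) := by gcongr
        _ = 5 / N * (T * M) := by field_simp
        _ ≤ (G + 5) / N * (T * M) := by gcongr; linarith
        _ ≤ _ := by gcongr
  have hV1i : ∀ k, Integrable fun t => V₁ t k := PN_int χ p N hU₁
  have hV2i : ∀ k, Integrable fun t => V₂ t k := PN_int χ p M hU₂
  have hV10 : ∀ t, ∀ k ∉ S1, V₁ t k = 0 := by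
    intro t k hk
    have : lpSymb χ N k = 0 := by
      by_contra h; exact hk ((hmem1 k).2 h)
    simp [hV₁, PN, this]
  have hV20 : ∀ t, ∀ k ∉ S2, V₂ t k = 0 := by
    intro t k hk
    have : lpSymb χ M k = 0 := by
      by_contra h; exact hk ((hmem2 k).2 h)
    simp [hV₂, PN, this]
  have ht1 := transf hχ p S1 V₁ hV1i hV10 (summable_PN hχ p N hU₁)
  have ht2 := transf hχ p S2 V₂ hV2i hV20 (summable_PN hχ p M hU₂)
  have hF1 := prof_int (p := p) S1 V₁ hV1i hV10 (ht1.trans_lt ENNReal.ofReal_lt_top)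
  have hF2 := prof_int (p := p) S2 V₂ hV2i hV20 (ht2.trans_lt ENNReal.ofReal_lt_top)
  have hX1 := Xhalf_nonneg χ p V₁
  have hX2 := Xhalf_nonneg χ p V₂
  set X1 := Xhalf χ p V₁ with hX1def
  set X2 := Xhalf χ p V₂ with hX2def
  have hmain := master p S1 S2 (fun k m => a k m) (fun k m => ha _ _) (prof p V₁) (prof p V₂)
    (fun k => (prof_cont p (hV1i k)).measurable) (fun k => (prof_cont p (hV2i k)).measurable)
    (fun σ k hk => prof_zero p (fun t => hV10 t k hk) σ) hF1 hF2 
    (ENNReal.ofReal ((G + 5) / N * (T * M) ^ θ)) (Ioo A B) hK V₁ V₂ 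
    (prof_inv hV1i hF1) (prof_inv hV2i hF2)
  have hD : 0 ≤ (G + 5) / N * (T * M) ^ θ * (X1 * X2) ^ 2 := by positivity
  have hfin : ∫ t in Ioo A B, l2sq (Lam a (V₁ t) (V₂ t)) ≤
      (G + 5) / N * (T * M) ^ θ * (X1 * X2) ^ 2 := by
    refine integral_l2sq_le _ _ hD ?_
    have e : ∀ t ξ, Lam a (V₁ t) (V₂ t) ξ =
        ∑ m ∈ S2, a ((ξ - m : ℤ)) m * V₁ t (ξ - m) * V₂ t m := fun t ξ =>
      Lam_eq a (V₁ t) (V₂ t) S2 (hV20 t) ξ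
    simp_rw [e]
    refine hmain.trans ?_
    rw [ENNReal.ofReal_mul (q := (X1 * X2) ^ 2) (by positivity), ENNReal.ofReal_pow (by positivity),
      ENNReal.ofReal_mul hX1]
    gcongr
  unfold L2normOn
  refine (Real.rpow_le_rpow (integral_nonneg fun t => tsum_nonneg fun _ => by positivity) hfin
    (by norm_num)).trans (le_of_eq ?_)
  rw [Real.mul_rpow (by positivity) (by positivity), Real.mul_rpow (by positivity) (by positivity),
    Real.mul_rpow hT0.le hM0.le, Real.div_rpow (by positivity) hN.le,
    Real.mul_rpow (by positivity) (by positivity), ← Real.rpow_mul hT0.le, ← Real.rpow_mul hM0.le,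
    ← Real.rpow_natCast (X1 * X2), ← Real.rpow_mul (by positivity), neg_div, Real.rpow_neg hN.le]
  norm_num
  rw [show θ * (1 / 2) = θ / 2 by ring]
  ring

/-- Proposition `prop_short4`, estimate (3.5):
short-time bilinear estimate, non-balanced case: for `N₁∨N₂ ≥ K₀(N₁∧N₂)`,
`θ ∈ [0,1]` and any interval `I = ]A,B[` with `|I| ≤ (N₁∨N₂)^{-1}T`,
`‖Λ_a(P_{N₁}u₁,P_{N₂}u₂)‖_{L²(I;L²)} ≤ C T^{θ/2}(N₁∧N₂)^{θ/2}(N₁∨N₂)^{-1/2} ⋯`. -/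
theorem short_time_bilinear_II
    (α ξ₀ c₀ C₀ : ℝ) (hα : α ∈ Set.Icc (1:ℝ) 2)
    (p : ℝ → ℝ) (hp : Hyp1 α ξ₀ c₀ C₀ p)
    (χ : ℝ → ℝ) (hχ : CutoffFun χ) :
    ∃ K₀ : ℝ, 1 ≤ K₀ ∧ ∃ C : ℝ, 0 < C ∧
      ∀ (T : ℝ), 0 < T → T < 1 →
      ∀ (n₁ n₂ : ℕ),
      ∀ (a : ℝ → ℝ → ℂ), (∀ x y : ℝ, ‖a x y‖ ≤ 1) →
      ∀ (U₁ U₂ : ℝ → ℤ → ℂ), MemX χ p U₁ → MemX χ p U₂ →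
        K₀ * min ((2:ℝ) ^ n₁) ((2:ℝ) ^ n₂) ≤ max ((2:ℝ) ^ n₁) ((2:ℝ) ^ n₂) →
      ∀ θ : ℝ, θ ∈ Set.Icc (0:ℝ) 1 →
      ∀ (A B : ℝ), B - A ≤ (max ((2:ℝ) ^ n₁) ((2:ℝ) ^ n₂))⁻¹ * T →
        L2normOn (Set.Ioo A B)
            (fun t => Lam a (PN χ ((2:ℝ) ^ n₁) (U₁ t)) (PN χ ((2:ℝ) ^ n₂) (U₂ t))) ≤
          C * T ^ (θ/2) * (min ((2:ℝ) ^ n₁) ((2:ℝ) ^ n₂)) ^ (θ/2) *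
            (max ((2:ℝ) ^ n₁) ((2:ℝ) ^ n₂)) ^ (-(1:ℝ)/2) *
            Xhalf χ p (fun t => PN χ ((2:ℝ) ^ n₁) (U₁ t)) *
            Xhalf χ p (fun t => PN χ ((2:ℝ) ^ n₂) (U₂ t)) := by
  obtain ⟨K₀, hK₀, C, hC, h⟩ := core α ξ₀ c₀ C₀ hα p hp χ hχ
  refine ⟨K₀, hK₀, C, hC, ?_⟩
  intro T hT0 hT1 n₁ n₂ a ha U₁ U₂ hU₁ hU₂ hKN θ hθ A B hAB
  rcases le_total ((2:ℝ) ^ n₂) ((2:ℝ) ^ n₁) with hle | hle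
  · rw [min_eq_right hle, max_eq_left hle] at *
    exact h T hT0 hT1 n₁ n₂ a ha U₁ U₂ hU₁ hU₂ hKN θ hθ A B hAB
  · rw [min_eq_left hle, max_eq_right hle] at *
    have := h T hT0 hT1 n₂ n₁ (fun x y => a y x) (fun x y => ha y x) U₂ U₁ hU₂ hU₁ hKN θ hθ A B hAB
    simp_rw [fun t => Lam_swap a (PN χ ((2:ℝ) ^ n₁) (U₁ t)) (PN χ ((2:ℝ) ^ n₂) (U₂ t))]
    refine this.trans (le_of_eq ?_)
    ring

end
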